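/- arXiv:1403.1155 — 4 statements merged into one kernel-verified Lean document; each statement's English description precedes it below -/
import Mathlib

section
/- Let R be a commutative ring and M a GP-pure projective R-module of finite Gorenstein projective dimension. Then M is Gorenstein projective. -/
open CategoryTheory Opposite Limits MonoidalCategory

universe u

variable {R : Type u} [CommRing R]

/-- `Q` is a Gorenstein projective module: it is the cokernel `Coker (P₁ → P₀)` of a totally
acyclic complex of projective modules, i.e. an exact complex of projectives which stays exact
under `Hom(-, P)` for every projective `P`. -/
def IsGorensteinProjective (Q : ModuleCat.{u} R) : Prop :=
  ∃ C : ChainComplex (ModuleCat.{u} R) ℤ,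
    (∀ i, Projective (C.X i)) ∧
    (∀ i, C.ExactAt i) ∧
    Nonempty (Q ≅ cokernel (C.d 1 0)) ∧
    ∀ P : ModuleCat.{u} R, Projective P →
      ∀ (i : ℤ) (f : C.X i ⟶ P), C.d (i + 1) i ≫ f = 0 →
        ∃ g : C.X (i - 1) ⟶ P, f = C.d i (i - 1) ≫ g

/-- `E` is a Gorenstein injective module: it is the kernel `Ker (I⁰ → I¹)` of a totally acyclic
complex of injective modules, i.e. an exact complex of injectives which stays exact under
`Hom(I, -)` for every injective `I`. -/
def IsGorensteinInjective (E : ModuleCat.{u} R) : Prop :=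
  ∃ C : CochainComplex (ModuleCat.{u} R) ℤ,
    (∀ i, Injective (C.X i)) ∧
    (∀ i, C.ExactAt i) ∧
    Nonempty (E ≅ kernel (C.d 0 1)) ∧
    ∀ I : ModuleCat.{u} R, Injective I →
      ∀ (i : ℤ) (f : I ⟶ C.X i), f ≫ C.d i (i + 1) = 0 →
        ∃ g : I ⟶ C.X (i - 1), f = g ≫ C.d (i - 1) i

/-- `M` is a Gorenstein flat module: it is a cokernel in an exact complex of flat modules which
remains exact after tensoring with any injective module. -/
def IsGorensteinFlat (M : ModuleCat.{u} R) : Prop :=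
  ∃ C : ChainComplex (ModuleCat.{u} R) ℤ,
    (∀ i, Module.Flat R (C.X i)) ∧
    (∀ i, C.ExactAt i) ∧
    Nonempty (M ≅ cokernel (C.d 1 0)) ∧
    ∀ I : ModuleCat.{u} R, Injective I → ∀ i : ℤ,
      (((tensorLeft I).mapHomologicalComplex (ComplexShape.down ℤ)).obj C).ExactAt i

/-- A short exact sequence `0 → X₁ → X₂ → X₃ → 0` is `𝒳`-pure exact if
`Hom(U, X₂) → Hom(U, X₃)` is surjective for every `U ∈ 𝒳`. -/
def XPureExact (𝒳 : ModuleCat.{u} R → Prop) (S : ShortComplex (ModuleCat.{u} R)) : Prop :=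
  ∀ U : ModuleCat.{u} R, 𝒳 U → ∀ φ : U ⟶ S.X₃, ∃ ψ : U ⟶ S.X₂, ψ ≫ S.g = φ

/-- A short exact sequence `0 → X₁ → X₂ → X₃ → 0` is `𝒳`-copure exact if
`Hom(X₂, V) → Hom(X₁, V)` is surjective for every `V ∈ 𝒳`. -/
def XCopureExact (𝒳 : ModuleCat.{u} R → Prop) (S : ShortComplex (ModuleCat.{u} R)) : Prop :=
  ∀ V : ModuleCat.{u} R, 𝒳 V → ∀ φ : S.X₁ ⟶ V, ∃ ψ : S.X₂ ⟶ V, S.f ≫ ψ = φ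

/-- `M` is `𝒳`-pure flat: `M ⊗ -` leaves every `𝒳`-pure exact short exact sequence exact. -/
def XPureFlat (𝒳 : ModuleCat.{u} R → Prop) (M : ModuleCat.{u} R) : Prop :=
  ∀ S : ShortComplex (ModuleCat.{u} R), S.ShortExact → XPureExact 𝒳 S →
    Function.Injective ((tensorLeft M).map S.f)

/-- `N` is `𝒳`-pure injective: `Hom(-, N)` leaves every `𝒳`-pure exact short exact
sequence exact. -/
def XPureInjective (𝒳 : ModuleCat.{u} R → Prop) (N : ModuleCat.{u} R) : Prop :=
  ∀ S : ShortComplex (ModuleCat.{u} R), S.ShortExact → XPureExact 𝒳 S →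
    ∀ φ : S.X₁ ⟶ N, ∃ ψ : S.X₂ ⟶ N, S.f ≫ ψ = φ

/-- `M` is `𝒳`-pure projective: `Hom(M, -)` leaves every `𝒳`-pure exact short exact
sequence exact. -/
def XPureProjective (𝒳 : ModuleCat.{u} R → Prop) (M : ModuleCat.{u} R) : Prop :=
  ∀ S : ShortComplex (ModuleCat.{u} R), S.ShortExact → XPureExact 𝒳 S →
    ∀ φ : M ⟶ S.X₃, ∃ ψ : M ⟶ S.X₂, ψ ≫ S.g = φ

/-- `GP`-pure exactness: `Hom(Q, -)` leaves the sequence exact for all Gorenstein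
projective `Q`. -/
abbrev GPPureExact (S : ShortComplex (ModuleCat.{u} R)) : Prop :=
  XPureExact IsGorensteinProjective S

/-- `GI`-copure exactness: `Hom(-, E)` leaves the sequence exact for all Gorenstein
injective `E`. -/
abbrev GICopureExact (S : ShortComplex (ModuleCat.{u} R)) : Prop :=
  XCopureExact IsGorensteinInjective S

abbrev GPPureProjective (M : ModuleCat.{u} R) : Prop :=
  XPureProjective IsGorensteinProjective M

abbrev GPPureInjective (M : ModuleCat.{u} R) : Prop :=
  XPureInjective IsGorensteinProjective M

abbrev GPPureFlat (M : ModuleCat.{u} R) : Prop :=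
  XPureFlat IsGorensteinProjective M

/-- `Ext^n_R(M, N)` vanishes. -/
abbrev extVanish (n : ℕ) (M N : ModuleCat.{u} R) : Prop :=
  Subsingleton (((Ext R (ModuleCat.{u} R) n).obj (op M)).obj N)

/-- `M` belongs to `GP^⊥`. -/
abbrev MemGPperp (M : ModuleCat.{u} R) : Prop :=
  ∀ Q : ModuleCat.{u} R, IsGorensteinProjective Q → extVanish 1 Q M

/-- `M` belongs to `^⊥GI`. -/
abbrev MemPerpGI (M : ModuleCat.{u} R) : Prop :=
  ∀ E : ModuleCat.{u} R, IsGorensteinInjective E → extVanish 1 M E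

/-- Gorenstein projective dimension of `M` is at most `n`: there is a resolution
`0 → G_n → ⋯ → G_0 → M → 0` by Gorenstein projective modules. -/
def GpdLE : ℕ → ModuleCat.{u} R → Prop
  | 0, M => IsGorensteinProjective M
  | n + 1, M =>
    ∃ S : ShortComplex (ModuleCat.{u} R), S.ShortExact ∧ Nonempty (S.X₃ ≅ M) ∧
      IsGorensteinProjective S.X₂ ∧ GpdLE n S.X₁

/-- Gorenstein injective dimension of `M` is at most `n`: there is a coresolution
`0 → M → E⁰ → ⋯ → Eⁿ → 0` by Gorenstein injective modules. -/
def GidLE : ℕ → ModuleCat.{u} R → Prop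
  | 0, M => IsGorensteinInjective M
  | n + 1, M =>
    ∃ S : ShortComplex (ModuleCat.{u} R), S.ShortExact ∧ Nonempty (S.X₁ ≅ M) ∧
      IsGorensteinInjective S.X₂ ∧ GidLE n S.X₃

/-- Gorenstein flat dimension of `M` is at most `n`. -/
def GfdLE : ℕ → ModuleCat.{u} R → Prop
  | 0, M => IsGorensteinFlat M
  | n + 1, M =>
    ∃ S : ShortComplex (ModuleCat.{u} R), S.ShortExact ∧ Nonempty (S.X₃ ≅ M) ∧
      IsGorensteinFlat S.X₂ ∧ GfdLE n S.X₁

/-- The Pontryagin dual `M⁺ = Hom_ℤ(M, ℚ/ℤ)` as an `R`-module. -/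
noncomputable def characterDual (M : ModuleCat.{u} R) : ModuleCat.{u} R :=
  ModuleCat.of R (CharacterModule M)

/-- `R` is a coherent ring: every finitely generated ideal is finitely presented. -/
def IsCoherentRing (R : Type u) [CommRing R] : Prop :=
  ∀ I : Ideal R, I.FG → Module.FinitePresentation R I

/-- `φ : G → M` is a Gorenstein projective precover. -/
def IsGPPrecover {G M : ModuleCat.{u} R} (φ : G ⟶ M) : Prop :=
  IsGorensteinProjective G ∧
    ∀ G' : ModuleCat.{u} R, IsGorensteinProjective G' →
      ∀ ψ : G' ⟶ M, ∃ χ : G' ⟶ G, χ ≫ φ = ψ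

/-- The short exact sequence `0 → Im d_{i+1} → X_i → Im d_i → 0` extracted from a complex. -/
noncomputable def imagesShortComplex (C : ChainComplex (ModuleCat.{u} R) ℤ) (i : ℤ) :
    ShortComplex (ModuleCat.{u} R) :=
  ShortComplex.mk (image.ι (C.d (i + 1) i)) (factorThruImage (C.d i (i - 1)))
    (by
      rw [← cancel_epi (factorThruImage (C.d (i + 1) i)),
        ← cancel_mono (image.ι (C.d i (i - 1)))]
      simp)

namespace GorensteinProjective

open Abelian

section AbelianCategory

universe v w

variable {C : Type w} [Category.{v} C] [Abelian C]

/-- `0 → X → Y → Z → 0` is a short exact sequence. -/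
def IsShortExact {X Y Z : C} (f : X ⟶ Y) (g : Y ⟶ Z) : Prop :=
  ∃ w : f ≫ g = 0, (ShortComplex.mk f g w).ShortExact

namespace IsShortExact

variable {X Y Z : C} {f : X ⟶ Y} {g : Y ⟶ Z}

lemma mono (h : IsShortExact f g) : Mono f := h.2.mono_f

lemma epi (h : IsShortExact f g) : Epi g := h.2.epi_g

lemma zero (h : IsShortExact f g) : f ≫ g = 0 := h.1

lemma exists_lift (h : IsShortExact f g) {A : C} (k : A ⟶ Y) (hk : k ≫ g = 0) :
    ∃ l : A ⟶ X, l ≫ f = k :=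
  have := h.2.mono_f
  ⟨h.2.exact.lift k hk, h.2.exact.lift_f k hk⟩

lemma exists_desc (h : IsShortExact f g) {A : C} (k : Y ⟶ A) (hk : f ≫ k = 0) :
    ∃ l : Z ⟶ A, g ≫ l = k :=
  have := h.2.epi_g
  ⟨h.2.exact.desc k hk, h.2.exact.g_desc k hk⟩

lemma of_desc [Mono f] [Epi g] (w : f ≫ g = 0)
    (H : ∀ {A : C} (k : Y ⟶ A), f ≫ k = 0 → ∃ l : Z ⟶ A, g ≫ l = k) : IsShortExact f g :=
  ⟨w, .mk' (ShortComplex.exact_of_g_is_cokernel _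
    (CokernelCofork.IsColimit.ofπ' g w fun k hk ↦ ⟨(H k hk).choose, (H k hk).choose_spec⟩))
    inferInstance inferInstance⟩

lemma of_mono (f : X ⟶ Y) [Mono f] : IsShortExact f (cokernel.π f) :=
  of_desc (cokernel.condition f) fun k hk ↦ ⟨cokernel.desc f k hk, by simp⟩

lemma of_epi (g : Y ⟶ Z) [Epi g] : IsShortExact (kernel.ι g) g :=
  ⟨kernel.condition g, .mk' (ShortComplex.exact_kernel g) inferInstance inferInstance⟩

lemma exact_comp (h : IsShortExact f g) {A B : C} (p : A ⟶ X) [Epi p] (m : Z ⟶ B) [Mono m] :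
    (ShortComplex.mk (p ≫ f) (g ≫ m) (by simp [reassoc_of% h.zero])).Exact := by
  let φ : ShortComplex.mk (p ≫ f) g (by simp [h.zero]) ⟶ ShortComplex.mk f g h.zero :=
    { τ₁ := p, τ₂ := 𝟙 _, τ₃ := 𝟙 _ }
  let ψ : ShortComplex.mk (p ≫ f) g (by simp [h.zero]) ⟶
      ShortComplex.mk (p ≫ f) (g ≫ m) (by simp [reassoc_of% h.zero]) :=
    { τ₁ := 𝟙 _, τ₂ := 𝟙 _, τ₃ := m }
  have : Epi φ.τ₁ := ‹Epi p›
  have : IsIso φ.τ₂ := inferInstanceAs (IsIso (𝟙 _))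
  have : Mono φ.τ₃ := inferInstanceAs (Mono (𝟙 _))
  have : Epi ψ.τ₁ := inferInstanceAs (Epi (𝟙 _))
  have : IsIso ψ.τ₂ := inferInstanceAs (IsIso (𝟙 _))
  have : Mono ψ.τ₃ := ‹Mono m›
  exact (ShortComplex.exact_iff_of_epi_of_isIso_of_mono ψ).1
    ((ShortComplex.exact_iff_of_epi_of_isIso_of_mono φ).2 h.2.exact)

lemma nonempty_iso_cokernel (h : IsShortExact f g) {A : C} (p : A ⟶ X) [Epi p]
    {d : A ⟶ Y} (hd : d = p ≫ f) : Nonempty (Z ≅ cokernel d) := by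
  subst hd
  have := h.2.epi_g
  exact ⟨h.2.exact.gIsCokernel.coconePointUniqueUpToIso (cokernelIsCokernel f) ≪≫
    (cokernelEpiComp p f).symm⟩

lemma of_exact {a : X ⟶ Y} {b : Y ⟶ Z} {w : a ≫ b = 0} (h : (ShortComplex.mk a b w).Exact) :
    IsShortExact (cokernel.desc a b w) (cokernel.π b) :=
  have : Mono (cokernel.desc a b w) := h.mono_cokernelDesc
  of_desc (by simp [← cancel_epi (cokernel.π a)]) fun k hk ↦
    ⟨cokernel.desc b k (by rw [← cokernel.π_desc a b w, Category.assoc, hk, comp_zero]), by simp⟩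

lemma iso_comp (h : IsShortExact f g) {X' : C} (e : X' ≅ X) : IsShortExact (e.hom ≫ f) g := by
  have := h.mono
  have := h.epi
  refine of_desc (by simp [h.zero]) fun k hk ↦ h.exists_desc k ?_
  rwa [Category.assoc, ← cancel_epi e.inv, e.inv_hom_id_assoc, comp_zero] at hk

lemma comp_iso (h : IsShortExact f g) {Z' : C} (e : Z ≅ Z') : IsShortExact f (g ≫ e.hom) := by
  have := h.mono
  have := h.epi
  refine of_desc (by simp [reassoc_of% h.zero]) fun k hk ↦ ?_
  obtain ⟨l, hl⟩ := h.exists_desc k hk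
  exact ⟨e.inv ≫ l, by simpa⟩

/-- In a pushout square, a short exact sequence starting with one side induces a short exact
sequence with the same cokernel starting with the opposite side. -/
lemma pushout (h : IsShortExact f g) {A P : C} {a : X ⟶ A} {j : Y ⟶ P} {i : A ⟶ P}
    (sq : IsPushout f a j i) : ∃ q : P ⟶ Z, j ≫ q = g ∧ IsShortExact i q := by
  have := h.mono
  have := h.epi
  have : Mono i := mono_inr_of_isColimit f a sq.isColimit
  have hj : j ≫ sq.desc g 0 (by simp [h.zero]) = g := by simp
  have : Epi (sq.desc g 0 (by simp [h.zero])) :=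
    epi_of_epi_fac hj
  refine ⟨_, hj, of_desc (by simp) fun k hk ↦ ?_⟩
  obtain ⟨l, hl⟩ := h.exists_desc (j ≫ k) (by rw [reassoc_of% sq.w, hk, comp_zero])
  exact ⟨l, sq.hom_ext (by simp [hl]) (by simp [hk])⟩

/-- The cokernel of a composition of monomorphisms is obtained as a pushout. -/
lemma comp_pushout (h : IsShortExact f g) {W P : C} {m : Y ⟶ W} [Mono m] {j : W ⟶ P} {i : Z ⟶ P}
    (sq : IsPushout m g j i) : IsShortExact (f ≫ m) j := by
  have := h.mono
  have := h.epi
  have : Epi j := ⟨fun u v huv ↦ sq.hom_ext huv (by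
    rw [← cancel_epi g, ← reassoc_of% sq.w, huv, reassoc_of% sq.w])⟩
  refine of_desc (by rw [Category.assoc, sq.w, reassoc_of% h.zero, zero_comp]) fun k hk ↦ ?_
  obtain ⟨l, hl⟩ := h.exists_desc (m ≫ k) (by simpa using hk)
  exact ⟨sq.desc k l hl.symm, by simp⟩

lemma of_splitting {S : ShortComplex C} (σ : S.Splitting) : IsShortExact σ.s σ.r := by
  have : Mono σ.s := mono_of_mono_fac σ.s_g
  have : Epi σ.r := epi_of_epi_fac σ.f_r
  refine of_desc σ.s_r fun k hk ↦ ⟨S.f ≫ k, ?_⟩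
  simpa [hk] using σ.id =≫ k

lemma biprod_of_retraction (h : IsShortExact f g) {r : Y ⟶ X} (hr : f ≫ r = 𝟙 X) {Q W : C}
    {b : Z ⟶ Q} {c : Q ⟶ W} (hb : IsShortExact b c) :
    IsShortExact (biprod.lift r (g ≫ b)) (biprod.snd ≫ c) := by
  have := h.epi
  have := hb.mono
  have := hb.epi
  have : Mono (biprod.lift r (g ≫ b)) := by
    refine Preadditive.mono_of_cancel_zero _ fun x hx ↦ ?_
    have hxr : x ≫ r = 0 := by simpa using hx =≫ biprod.fst
    have hxg : (x ≫ g) ≫ b = 0 := by simpa using hx =≫ biprod.snd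
    obtain ⟨y, rfl⟩ := h.exists_lift x (zero_of_comp_mono b hxg)
    rw [Category.assoc, hr, Category.comp_id] at hxr
    rw [hxr, zero_comp]
  refine of_desc (by simp [hb.zero]) fun k hk ↦ ?_
  have hinl : f ≫ biprod.lift r (g ≫ b) = biprod.inl := by
    ext <;> simp [hr, reassoc_of% h.zero]
  have hk₁ : biprod.inl ≫ k = 0 := by rw [← hinl, Category.assoc, hk, comp_zero]
  have hk₂ : biprod.snd ≫ biprod.inr ≫ k = k := by
    ext <;> simp [hk₁]
  obtain ⟨l, hl⟩ := hb.exists_desc (biprod.inr ≫ k) (by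
    rw [← cancel_epi g, comp_zero, ← hk, ← hk₂]
    simp)
  exact ⟨l, by rw [Category.assoc, hl, hk₂]⟩

end IsShortExact

lemma exists_projective_presentation [EnoughProjectives C] (X : C) :
    ∃ (K P : C) (f : K ⟶ P) (g : P ⟶ X), IsShortExact f g ∧ Projective P :=
  ⟨_, _, _, Projective.π X, .of_epi _, inferInstance⟩

variable [HasExt.{v} C]

/-- All the groups `Ext^i(X, Y)` for `i ≥ 1` vanish. -/
def ExtOrthogonal (X Y : C) : Prop := ∀ (i : ℕ) (e : Ext X Y (i + 1)), e = 0

namespace IsShortExact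

variable {X Y Z : C} {f : X ⟶ Y} {g : Y ⟶ Z}

lemma exists_lift_of_ext (h : IsShortExact f g) {A : C} (hA : ∀ e : Ext A X 1, e = 0)
    (k : A ⟶ Z) : ∃ l : A ⟶ Y, l ≫ g = k := by
  obtain ⟨x, hx⟩ := Ext.covariant_sequence_exact₃ A h.2 (Ext.mk₀ k) (zero_add 1) (hA _)
  obtain ⟨l, rfl⟩ := (Ext.mk₀_bijective _ _).2 x
  exact ⟨l, (Ext.mk₀_bijective _ _).1 (by simpa using hx)⟩

lemma exists_extension_of_ext (h : IsShortExact f g) {A : C} (hA : ∀ e : Ext Z A 1, e = 0)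
    (k : X ⟶ A) : ∃ l : Y ⟶ A, f ≫ l = k := by
  obtain ⟨x, hx⟩ := Ext.contravariant_sequence_exact₁ h.2 A (Ext.mk₀ k) (add_zero 1) (hA _)
  obtain ⟨l, rfl⟩ := (Ext.mk₀_bijective _ _).2 x
  exact ⟨l, (Ext.mk₀_bijective _ _).1 (by simpa using hx)⟩

lemma ext_one_eq_zero (h : IsShortExact f g) (hY : Projective Y) {A : C}
    (hA : ∀ k : X ⟶ A, ∃ l : Y ⟶ A, f ≫ l = k) (e : Ext Z A 1) : e = 0 := by
  obtain ⟨x, rfl⟩ := Ext.contravariant_sequence_exact₃ h.2 A e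
    (Ext.eq_zero_of_projective _) (add_zero 1)
  obtain ⟨k, rfl⟩ := (Ext.mk₀_bijective _ _).2 x
  obtain ⟨l, rfl⟩ := hA k
  simpa only [Ext.mk₀_comp_mk₀] using h.2.extClass_comp_assoc (Ext.mk₀ l) (h := add_zero 1)

lemma ext_succ_eq_zero (h : IsShortExact f g) (hY : Projective Y) {A : C} {n : ℕ}
    (hA : ∀ e : Ext X A (n + 1), e = 0) (e : Ext Z A (n + 2)) : e = 0 := by
  obtain ⟨x, rfl⟩ := Ext.contravariant_sequence_exact₃ h.2 A e
    (Ext.eq_zero_of_projective _) (add_comm 1 (n + 1))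
  rw [hA x, Ext.comp_zero]

lemma extOrthogonal_middle (h : IsShortExact f g) {A : C} (hX : ExtOrthogonal X A)
    (hZ : ExtOrthogonal Z A) : ExtOrthogonal Y A := by
  intro i e
  obtain ⟨x, rfl⟩ := Ext.contravariant_sequence_exact₂ h.2 A e (hX i _)
  rw [hZ i x, Ext.comp_zero]

lemma extOrthogonal_left (h : IsShortExact f g) {A : C} (hY : ExtOrthogonal Y A)
    (hZ : ExtOrthogonal Z A) : ExtOrthogonal X A := by
  intro i e
  obtain ⟨x, rfl⟩ := Ext.contravariant_sequence_exact₁ h.2 A e (add_comm 1 (i + 1)) (hZ _ _)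
  rw [hY i x, Ext.comp_zero]

lemma extOrthogonal_right (h : IsShortExact f g) {A : C} (hX : ExtOrthogonal A X)
    (hY : ExtOrthogonal A Y) : ExtOrthogonal A Z := by
  intro i e
  obtain ⟨x, rfl⟩ := Ext.covariant_sequence_exact₃ A h.2 e rfl (hX _ _)
  rw [hY i x, Ext.zero_comp]

end IsShortExact

lemma extOrthogonal_of_projective (X Y : C) [Projective X] : ExtOrthogonal X Y :=
  fun _ e ↦ Ext.eq_zero_of_projective e

lemma ExtOrthogonal.of_retract {X Y A : C} (r : Retract X Y) (h : ExtOrthogonal Y A) :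
    ExtOrthogonal X A := by
  intro i e
  rw [← e.mk₀_id_comp, ← r.retract, ← Ext.mk₀_comp_mk₀, Ext.comp_assoc_of_second_deg_zero,
    h i ((Ext.mk₀ r.r).comp e (zero_add _)), Ext.comp_zero]

variable [EnoughProjectives C]

lemma ExtOrthogonal.of_hasProjectiveDimensionLT {X : C}
    (hX : ∀ P : C, Projective P → ExtOrthogonal X P) (n : ℕ) :
    ∀ Y : C, HasProjectiveDimensionLT Y (n + 1) → ExtOrthogonal X Y := by
  induction n with
  | zero =>
    intro Y hY
    exact hX Y (projective_iff_hasProjectiveDimensionLT_one.2 hY)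
  | succ n ih =>
    intro Y hY
    obtain ⟨K, P, f, g, h, hP⟩ := exists_projective_presentation Y
    exact h.extOrthogonal_right (ih K ((h.2.hasProjectiveDimensionLT_X₃_iff n hP).1 hY)) (hX P hP)

lemma projective_of_extOrthogonal {X : C}
    (hX : ∀ P : C, Projective P → ExtOrthogonal X P) (n : ℕ)
    (hn : HasProjectiveDimensionLT X (n + 1)) : Projective X := by
  cases n with
  | zero => exact projective_iff_hasProjectiveDimensionLT_one.2 hn
  | succ n =>
    obtain ⟨K, P, f, g, h, hP⟩ := exists_projective_presentation X
    have hK : ExtOrthogonal X K :=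
      .of_hasProjectiveDimensionLT hX n K ((h.2.hasProjectiveDimensionLT_X₃_iff n hP).1 hn)
    obtain ⟨s, hs⟩ := h.exists_lift_of_ext (hK 0) (𝟙 X)
    exact (Retract.mk s g hs).projective

end AbelianCategory

section ModuleCategory

/-- A class of modules all of whose members have vanishing first extension group with coefficients
in projective modules, and can be presented as quotients and as submodules of projective modules
inside the class. -/
structure IsTotallyAcyclicClass (𝒢 : ModuleCat.{u} R → Prop) : Prop where
  cover : ∀ Z, 𝒢 Z → ∃ (X P : ModuleCat.{u} R) (f : X ⟶ P) (g : P ⟶ Z),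
    IsShortExact f g ∧ Projective P ∧ 𝒢 X
  embed : ∀ X, 𝒢 X → ∃ (P Z : ModuleCat.{u} R) (f : X ⟶ P) (g : P ⟶ Z),
    IsShortExact f g ∧ Projective P ∧ 𝒢 Z
  ext_one : ∀ X, 𝒢 X → ∀ P : ModuleCat.{u} R, Projective P → ∀ e : Ext X P 1, e = 0

lemma exists_int_sequence {T : Type*} (r : T → T → Prop) (hs : ∀ x, ∃ y, r y x)
    (hp : ∀ x, ∃ y, r x y) (x : T) : ∃ s : ℤ → T, s 0 = x ∧ ∀ i, r (s (i + 1)) (s i) := by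
  choose a ha using hs
  choose b hb using hp
  refine ⟨fun
    | .ofNat n => a^[n] x
    | .negSucc n => b^[n + 1] x, rfl, fun
    | .ofNat n => ?_
    | .negSucc 0 => hb x
    | .negSucc (n + 1) => ?_⟩
  · change r (a^[n + 1] x) (a^[n] x)
    rw [Function.iterate_succ_apply']
    exact ha _
  · change r (b^[n + 1] x) (b^[n + 1 + 1] x)
    rw [Function.iterate_succ_apply' b (n + 1)]
    exact hb _

lemma exactAt_iff_exact (C : ChainComplex (ModuleCat.{u} R) ℤ) (i : ℤ) :
    C.ExactAt (i + 1) ↔ (ShortComplex.mk (C.d (i + 1 + 1) (i + 1)) (C.d (i + 1) i)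
      (C.d_comp_d _ _ _)).Exact :=
  C.exactAt_iff' _ _ _ (by simp) (by simp)

lemma IsTotallyAcyclicClass.isGorensteinProjective {𝒢 : ModuleCat.{u} R → Prop}
    (h𝒢 : IsTotallyAcyclicClass 𝒢) {Q : ModuleCat.{u} R} (hQ : 𝒢 Q) :
    IsGorensteinProjective Q := by
  obtain ⟨s, hs₀, hs⟩ := exists_int_sequence
    (fun X Z : {X // 𝒢 X} ↦ ∃ (P : ModuleCat.{u} R) (f : X.1 ⟶ P) (g : P ⟶ Z.1),
      IsShortExact f g ∧ Projective P)
    (fun Z ↦ by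
      obtain ⟨X, P, f, g, h, hP, hX⟩ := h𝒢.cover Z.1 Z.2
      exact ⟨⟨X, hX⟩, P, f, g, h, hP⟩)
    (fun X ↦ by
      obtain ⟨P, Z, f, g, h, hP, hZ⟩ := h𝒢.embed X.1 X.2
      exact ⟨⟨Z, hZ⟩, P, f, g, h, hP⟩) ⟨Q, hQ⟩
  choose P f g h hP using hs
  have hmono i : Mono (f i) := (h i).mono
  have hepi i : Epi (g i) := (h i).epi
  let C : ChainComplex (ModuleCat.{u} R) ℤ := .of P (fun i ↦ g (i + 1) ≫ f i) fun i ↦ by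
    simp [reassoc_of% (h (i + 1)).zero]
  have hd i : C.d (i + 1) i = g (i + 1) ≫ f i := ChainComplex.of_d P (fun i ↦ g (i + 1) ≫ f i) i
  refine ⟨C, hP, fun i ↦ ?_, ?_, ?_⟩
  · obtain ⟨i, rfl⟩ : ∃ j, i = j + 1 := ⟨i - 1, by simp⟩
    rw [exactAt_iff_exact]
    convert (h (i + 1)).exact_comp (g (i + 1 + 1)) (f i) using 2
    exacts [hd _, hd _]
  · have := (h 0).nonempty_iso_cokernel (g (0 + 1)) (hd 0)
    rw [hs₀] at this
    exact this
  · intro A hA i k hk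
    have key : ∀ (i j : ℤ) (_ : j + 1 = i) (k : C.X i ⟶ A), C.d (i + 1) i ≫ k = 0 →
        ∃ l : C.X j ⟶ A, k = C.d i j ≫ l := by
      rintro _ j rfl k hk
      rw [hd, Category.assoc] at hk
      obtain ⟨l, hl⟩ := (h (j + 1)).exists_desc k
        ((cancel_epi (g (j + 1 + 1))).1 (hk.trans comp_zero.symm))
      obtain ⟨m, hm⟩ := (h j).exists_extension_of_ext (h𝒢.ext_one _ (s j).2 A hA) l
      exact ⟨m, by rw [hd, Category.assoc, hm, hl]⟩
    exact key i (i - 1) (by simp) k hk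

lemma isTotallyAcyclicClass_isGorensteinProjective :
    IsTotallyAcyclicClass (R := R) IsGorensteinProjective := by
  let 𝒢 (Q : ModuleCat.{u} R) : Prop := ∃ C : ChainComplex (ModuleCat.{u} R) ℤ,
    (∀ i, Projective (C.X i)) ∧ (∀ i, C.ExactAt i) ∧
    (∀ P : ModuleCat.{u} R, Projective P → ∀ (i : ℤ) (f : C.X i ⟶ P), C.d (i + 1) i ≫ f = 0 →
      ∃ g : C.X (i - 1) ⟶ P, f = C.d i (i - 1) ≫ g) ∧
    ∃ i, Nonempty (Q ≅ cokernel (C.d (i + 1) i))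
  have hses (C : ChainComplex (ModuleCat.{u} R) ℤ) (hC : ∀ i, C.ExactAt i) (i : ℤ) :=
    IsShortExact.of_exact ((exactAt_iff_exact C i).1 (hC (i + 1)))
  have h𝒢 : IsTotallyAcyclicClass 𝒢 := by
    refine ⟨?_, ?_, ?_⟩
    · rintro Z ⟨C, hP, hC, hA, i, ⟨e⟩⟩
      exact ⟨_, _, _, _, (hses C hC i).comp_iso e.symm, hP i, C, hP, hC, hA, i + 1, ⟨.refl _⟩⟩
    · rintro X ⟨C, hP, hC, hA, i, ⟨e⟩⟩
      obtain ⟨i, rfl⟩ : ∃ j, i = j + 1 := ⟨i - 1, by simp⟩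
      exact ⟨_, _, _, _, (hses C hC i).iso_comp e, hP i, C, hP, hC, hA, i, ⟨.refl _⟩⟩
    · rintro X ⟨C, hP, hC, hA, i, ⟨e⟩⟩ A hA'
      refine ((hses C hC i).comp_iso e.symm).ext_one_eq_zero (hP i) fun k ↦ ?_
      have key : ∀ (j i : ℤ) (_ : j = i + 1) (k : C.X j ⟶ A), C.d (j + 1) j ≫ k = 0 →
          ∃ l : C.X i ⟶ A, k = C.d j i ≫ l := by
        intro j i hij k hk
        obtain rfl : i = j - 1 := by simp [hij]
        exact hA A hA' j k hk
      obtain ⟨l, hl⟩ := key (i + 1) i rfl (cokernel.π _ ≫ k) (by simp)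
      exact ⟨l, by simp [← cancel_epi (cokernel.π (C.d (i + 1 + 1) (i + 1))), hl]⟩
  have : IsGorensteinProjective = 𝒢 := by
    ext Q
    refine ⟨?_, h𝒢.isGorensteinProjective⟩
    rintro ⟨C, hP, hC, hQ, hA⟩
    exact ⟨C, hP, hC, hA, 0, hQ⟩
  rwa [this]

lemma IsTotallyAcyclicClass.extOrthogonal {𝒢 : ModuleCat.{u} R → Prop}
    (h𝒢 : IsTotallyAcyclicClass 𝒢) (P : ModuleCat.{u} R) (hP : Projective P) :
    ∀ X, 𝒢 X → ExtOrthogonal X P := by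
  intro X hX i
  induction i generalizing X with
  | zero => exact h𝒢.ext_one X hX P hP
  | succ i ih =>
    obtain ⟨Y, Q, f, g, h, hQ, hY⟩ := h𝒢.cover X hX
    exact h.ext_succ_eq_zero hQ (ih Y hY)

lemma _root_.IsGorensteinProjective.extOrthogonal {X P : ModuleCat.{u} R}
    (hX : IsGorensteinProjective X) (hP : Projective P) : ExtOrthogonal X P :=
  isTotallyAcyclicClass_isGorensteinProjective.extOrthogonal P hP X hX

lemma _root_.IsGorensteinProjective.exists_embedding {X : ModuleCat.{u} R}
    (hX : IsGorensteinProjective X) : ∃ (P Z : ModuleCat.{u} R) (f : X ⟶ P) (g : P ⟶ Z),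
      IsShortExact f g ∧ Projective P ∧ IsGorensteinProjective Z :=
  isTotallyAcyclicClass_isGorensteinProjective.embed X hX

/-- The closure of a class of modules under syzygies. -/
inductive SyzygyClosure (𝒢 : ModuleCat.{u} R → Prop) : ModuleCat.{u} R → Prop
  | of {X : ModuleCat.{u} R} (hX : 𝒢 X) : SyzygyClosure 𝒢 X
  | syzygy {X P Z : ModuleCat.{u} R} {f : X ⟶ P} {g : P ⟶ Z} (h : IsShortExact f g)
      (hP : Projective P) (hZ : SyzygyClosure 𝒢 Z) : SyzygyClosure 𝒢 X

/-- A module is Gorenstein projective if it belongs to a class of modules which are left orthogonal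
to the projective modules and embed in projective modules with cokernel in the class. -/
lemma isGorensteinProjective_of_embed {𝒢 : ModuleCat.{u} R → Prop}
    (horth : ∀ X, 𝒢 X → ∀ P : ModuleCat.{u} R, Projective P → ExtOrthogonal X P)
    (hembed : ∀ X, 𝒢 X → ∃ (P Z : ModuleCat.{u} R) (f : X ⟶ P) (g : P ⟶ Z),
      IsShortExact f g ∧ Projective P ∧ 𝒢 Z) {X : ModuleCat.{u} R} (hX : 𝒢 X) :
    IsGorensteinProjective X := by
  refine IsTotallyAcyclicClass.isGorensteinProjective (𝒢 := SyzygyClosure 𝒢)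
    ⟨fun Z hZ ↦ ?_, fun X hX ↦ ?_, fun X hX P hP ↦ ?_⟩ (.of hX)
  · obtain ⟨K, P, f, g, h, hP⟩ := exists_projective_presentation Z
    exact ⟨K, P, f, g, h, hP, .syzygy h hP hZ⟩
  · cases hX with
    | of hX =>
      obtain ⟨P, Z, f, g, h, hP, hZ⟩ := hembed X hX
      exact ⟨P, Z, f, g, h, hP, .of hZ⟩
    | syzygy h hP hZ => exact ⟨_, _, _, _, h, hP, hZ⟩
  · suffices ExtOrthogonal X P from this 0
    induction hX with
    | of hX => exact horth _ hX P hP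
    | syzygy h hQ _ ih => exact h.extOrthogonal_left (extOrthogonal_of_projective _ _) ih

lemma IsShortExact.isGorensteinProjective_left {X P Z : ModuleCat.{u} R} {f : X ⟶ P} {g : P ⟶ Z}
    (h : IsShortExact f g) (hP : Projective P) (hZ : IsGorensteinProjective Z) :
    IsGorensteinProjective X := by
  refine isGorensteinProjective_of_embed
    (𝒢 := fun X ↦ ∃ (P Z : ModuleCat.{u} R) (f : X ⟶ P) (g : P ⟶ Z),
      IsShortExact f g ∧ Projective P ∧ IsGorensteinProjective Z) ?_ ?_ ⟨P, Z, f, g, h, hP, hZ⟩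
  · rintro X ⟨P, Z, f, g, h, hP, hZ⟩ Q hQ
    exact h.extOrthogonal_left (extOrthogonal_of_projective _ _) (hZ.extOrthogonal hQ)
  · rintro X ⟨P, Z, f, g, h, hP, hZ⟩
    exact ⟨P, Z, f, g, h, hP, hZ.exists_embedding⟩

lemma isGorensteinProjective_of_projective {P : ModuleCat.{u} R} (hP : Projective P) :
    IsGorensteinProjective P := by
  refine isGorensteinProjective_of_embed (𝒢 := fun P ↦ Projective P)
    (fun X hX Q _ ↦ extOrthogonal_of_projective X Q)
    (fun X hX ↦ ⟨X, _, 𝟙 X, _, .of_mono _, hX, ?_⟩) hP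
  exact (isZero_cokernel_of_epi (𝟙 X)).projective

lemma IsShortExact.isGorensteinProjective_middle {A H B : ModuleCat.{u} R} {f : A ⟶ H} {g : H ⟶ B}
    (h : IsShortExact f g) (hA : IsGorensteinProjective A) (hB : IsGorensteinProjective B) :
    IsGorensteinProjective H := by
  refine isGorensteinProjective_of_embed
    (𝒢 := fun H ↦ ∃ (A B : ModuleCat.{u} R) (f : A ⟶ H) (g : H ⟶ B),
      IsShortExact f g ∧ IsGorensteinProjective A ∧ IsGorensteinProjective B) ?_ ?_
    ⟨A, B, f, g, h, hA, hB⟩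
  · rintro H ⟨A, B, f, g, h, hA, hB⟩ Q hQ
    exact h.extOrthogonal_middle (hA.extOrthogonal hQ) (hB.extOrthogonal hQ)
  · rintro H ⟨A, B, f, g, h, hA, hB⟩
    obtain ⟨P, A', a, a', ha, hP, hA'⟩ := hA.exists_embedding
    obtain ⟨Q, B', b, b', hb, hQ, hB'⟩ := hB.exists_embedding
    have sq := IsPushout.of_hasPushout f a
    obtain ⟨q, -, hq⟩ := h.pushout sq
    obtain ⟨p, -, hp⟩ := ha.pushout sq.flip
    obtain ⟨r, hr⟩ := hq.exists_extension_of_ext (hB.extOrthogonal hP 0) (𝟙 P)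
    have hE := hq.biprod_of_retraction hr hb
    have := hE.mono
    have sq' := IsPushout.of_hasPushout (biprod.lift r (q ≫ b)) p
    obtain ⟨t, -, ht⟩ := hE.pushout sq'
    exact ⟨_, _, _, _, hp.comp_pushout sq', inferInstance, _, _, _, _, ht, hA', hB'⟩

/-- A module of finite Gorenstein projective dimension is a quotient of a Gorenstein projective
module by a submodule of finite projective dimension. -/
lemma exists_approximation (n : ℕ) : ∀ M : ModuleCat.{u} R, GpdLE n M →
    ∃ (K G : ModuleCat.{u} R) (f : K ⟶ G) (g : G ⟶ M), IsShortExact f g ∧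
      IsGorensteinProjective G ∧ ∃ m, HasProjectiveDimensionLT K (m + 1) := by
  induction n with
  | zero =>
    intro M hM
    refine ⟨_, M, _, 𝟙 M, .of_epi _, hM, 0, ?_⟩
    have := (isZero_kernel_of_mono (𝟙 M)).projective
    infer_instance
  | succ n ih =>
    rintro M ⟨S, hS, ⟨e⟩, hG₀, hS₁⟩
    have h₀ : IsShortExact S.f (S.g ≫ e.hom) := IsShortExact.comp_iso ⟨S.zero, hS⟩ e
    obtain ⟨K, G, f, g, h, hG, m, hK⟩ := ih S.X₁ hS₁
    obtain ⟨P, G', a, a', ha, hP, hG'⟩ := hG.exists_embedding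
    have := ha.mono
    have sq := IsPushout.of_hasPushout a g
    obtain ⟨q, -, hq⟩ := ha.pushout sq
    have hL := h.comp_pushout sq
    have sq' := IsPushout.of_hasPushout S.f (pushout.inr a g)
    obtain ⟨t, -, ht⟩ := h₀.pushout sq'
    obtain ⟨t', -, ht'⟩ := hq.pushout sq'.flip
    refine ⟨_, _, _, _, ht, ht'.isGorensteinProjective_middle hG₀ hG', m + 1, ?_⟩
    exact (hL.2.hasProjectiveDimensionLT_X₃_iff m hP).2 hK

end ModuleCategory

end GorensteinProjective

/-- A `GP`-pure projective module of finite Gorenstein projective dimension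
is Gorenstein projective. -/
theorem stmt4 {R : Type u} [CommRing R] (M : ModuleCat.{u} R)
    (hM : GPPureProjective M) (hfin : ∃ n : ℕ, GpdLE n M) :
    IsGorensteinProjective M := by
  open GorensteinProjective in
  obtain ⟨n, hn⟩ := hfin
  obtain ⟨K, G, f, g, h, hG, m, hK⟩ := exists_approximation n M hn
  obtain ⟨s, hs⟩ := hM _ h.2 (fun U hU ↦ h.exists_lift_of_ext
    (ExtOrthogonal.of_hasProjectiveDimensionLT (fun P hP ↦ hU.extOrthogonal hP) m K hK 0)) (𝟙 M)
  have σ := ShortComplex.Splitting.ofExactOfSection _ h.2.exact s hs h.mono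
  have hKP : Projective K := projective_of_extOrthogonal
    (fun P hP ↦ .of_retract ⟨f, σ.r, σ.f_r⟩ (hG.extOrthogonal hP)) m hK
  obtain ⟨P, G', a, a', ha, hP, hG'⟩ := hG.exists_embedding
  have := ha.mono
  have sq := IsPushout.of_hasPushout a σ.r
  obtain ⟨q, -, hq⟩ := ha.pushout sq
  exact ((IsShortExact.of_splitting σ).comp_pushout sq).isGorensteinProjective_left hP
    (hq.isGorensteinProjective_middle (isGorensteinProjective_of_projective hKP) hG')
end

section
/- Let R be a commutative ring such that every R-module in ^⊥(GP^⊥) admits a Gorenstein projective precover. Then the class of Gorenstein projective R-modules coincides with the class of GP-pure projective R-modules. -/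
open CategoryTheory Opposite Limits MonoidalCategory

universe u

variable {R : Type u} [CommRing R]

/-- `A` is a syzygy of `B`, with respect to a projective module, along a short exact sequence
`0 → A → P → B → 0` that stays exact under `Hom(-, Q)` for every projective `Q`. -/
def IsTotalSyzygy (A B : ModuleCat.{u} R) : Prop :=
  ∃ (P : ModuleCat.{u} R) (f : A ⟶ P) (g : P ⟶ B) (w : f ≫ g = 0),
    Projective P ∧ (ShortComplex.mk f g w).ShortExact ∧
      XCopureExact (fun Q => Projective Q) (ShortComplex.mk f g w)

/-- A class of modules closed under taking total syzygies and cosyzygies propagates along `ℤ`. -/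
lemma exists_int_syzygies {𝒮 : ModuleCat.{u} R → Prop}
    (hl : ∀ M, 𝒮 M → ∃ K, 𝒮 K ∧ IsTotalSyzygy K M)
    (hr : ∀ M, 𝒮 M → ∃ C, 𝒮 C ∧ IsTotalSyzygy M C) {M : ModuleCat.{u} R} (hM : 𝒮 M) :
    ∃ N : ℤ → ModuleCat.{u} R, N 0 = M ∧ ∀ i, IsTotalSyzygy (N (i + 1)) (N i) := by
  choose l hl hl' using hl
  choose r hr hr' using hr
  let L : ℕ → {X // 𝒮 X} := fun n => Nat.rec ⟨M, hM⟩ (fun _ X => ⟨l X.1 X.2, hl X.1 X.2⟩) n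
  let U : ℕ → {X // 𝒮 X} := fun n => Nat.rec ⟨M, hM⟩ (fun _ X => ⟨r X.1 X.2, hr X.1 X.2⟩) n
  let N : ℤ → ModuleCat.{u} R := fun i => Int.casesOn i (fun n => (L n).1) (fun n => (U (n + 1)).1)
  refine ⟨N, rfl, fun i => ?_⟩
  match i with
  | Int.ofNat n => exact hl' (L n).1 (L n).2
  | Int.negSucc 0 => exact hr' M hM
  | Int.negSucc (n + 1) => exact hr' (U (n + 1)).1 (U (n + 1)).2

lemma chainComplex_exactAt_iff (C : ChainComplex (ModuleCat.{u} R) ℤ) (i j k : ℤ)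
    (hij : j + 1 = i) (hjk : k + 1 = j) :
    C.ExactAt j ↔ (ShortComplex.mk _ _ (C.d_comp_d i j k)).Exact :=
  C.exactAt_iff' i j k ((ComplexShape.down ℤ).prev_eq' hij) ((ComplexShape.down ℤ).next_eq' hjk)

/-- Splicing a family of total syzygies gives a totally acyclic complex. -/
lemma isGorensteinProjective_of_syzygies {N : ℤ → ModuleCat.{u} R}
    (hN : ∀ i, IsTotalSyzygy (N (i + 1)) (N i)) : IsGorensteinProjective (N 0) := by
  choose P f g w hP hS hQ using hN
  have mf : ∀ i, Mono (f i) := fun i => (hS i).mono_f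
  have eg : ∀ i, Epi (g i) := fun i => (hS i).epi_g
  let C : ChainComplex (ModuleCat.{u} R) ℤ :=
    ChainComplex.of P (fun i => g (i + 1) ≫ f i) (fun i => by
      rw [Category.assoc, reassoc_of% (w (i + 1)), zero_comp, comp_zero])
  have hd : ∀ i, C.d (i + 1) i = g (i + 1) ≫ f i := fun i =>
    ChainComplex.of_d P (fun i => g (i + 1) ≫ f i) i
  have hex : ∀ k : ℤ, C.ExactAt (k + 1) := fun k => by
    rw [chainComplex_exactAt_iff C (k + 1 + 1) (k + 1) k rfl rfl]
    have e : (ShortComplex.mk (f (k + 1)) (g (k + 1) ≫ f k)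
        (by rw [reassoc_of% (w (k + 1)), zero_comp])).Exact := by
      let φ : ShortComplex.mk (f (k + 1)) (g (k + 1)) (w (k + 1)) ⟶
          ShortComplex.mk (f (k + 1)) (g (k + 1) ≫ f k)
            (by rw [reassoc_of% (w (k + 1)), zero_comp]) :=
        { τ₁ := 𝟙 _, τ₂ := 𝟙 _, τ₃ := f k }
      have : Epi φ.τ₁ := inferInstanceAs (Epi (𝟙 _))
      have : IsIso φ.τ₂ := inferInstanceAs (IsIso (𝟙 _))
      have : Mono φ.τ₃ := mf k
      exact (ShortComplex.exact_iff_of_epi_of_isIso_of_mono φ).1 (hS (k + 1)).exact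
    let φ : ShortComplex.mk _ _ (C.d_comp_d (k + 1 + 1) (k + 1) k) ⟶
        ShortComplex.mk (f (k + 1)) (g (k + 1) ≫ f k)
          (by rw [reassoc_of% (w (k + 1)), zero_comp]) :=
      { τ₁ := g (k + 1 + 1), τ₂ := 𝟙 _, τ₃ := 𝟙 _
        comm₁₂ := by
          dsimp only
          rw [hd]
          exact (Category.comp_id _).symm
        comm₂₃ := by
          dsimp only
          rw [hd]
          exact (Category.id_comp _).trans (Category.comp_id _).symm }
    have : Epi φ.τ₁ := eg _
    have : IsIso φ.τ₂ := inferInstanceAs (IsIso (𝟙 _))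
    have : Mono φ.τ₃ := inferInstanceAs (Mono (𝟙 _))
    exact (ShortComplex.exact_iff_of_epi_of_isIso_of_mono φ).2 e
  have hlift : ∀ Q : ModuleCat.{u} R, Projective Q → ∀ i j : ℤ, j + 1 = i → ∀ φ : C.X i ⟶ Q,
      C.d (i + 1) i ≫ φ = 0 → ∃ ψ : C.X j ⟶ Q, φ = C.d i j ≫ ψ := by
    rintro Q hQ' _ j rfl φ hφ
    rw [hd, Category.assoc] at hφ
    have h0 : f (j + 1) ≫ φ = 0 := by
      rw [← cancel_epi (g (j + 1 + 1)), hφ, comp_zero]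
    have : Epi (ShortComplex.mk _ _ (w (j + 1))).g := eg (j + 1)
    obtain ⟨φ', hφ'⟩ := (hS (j + 1)).exact.desc' φ h0
    obtain ⟨ψ, hψ⟩ := hQ j Q hQ' φ'
    refine ⟨ψ, ?_⟩
    rw [hd, Category.assoc]
    exact hφ'.symm.trans (congrArg (g (j + 1) ≫ ·) hψ.symm)
  refine ⟨C, hP, fun i => ?_, ?_, fun Q hQ' i φ hφ => hlift Q hQ' i (i - 1) (by omega) φ hφ⟩
  · obtain ⟨k, rfl⟩ : ∃ k, i = k + 1 := ⟨i - 1, by omega⟩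
    exact hex k
  · have h10 : C.d 1 0 = g 1 ≫ f 0 := hd 0
    have := eg 1
    have : Epi (ShortComplex.mk _ _ (w 0)).g := eg 0
    refine ⟨(hS 0).gIsCokernel.coconePointUniqueUpToIso (cokernelIsCokernel (f 0)) ≪≫
      (cokernelEpiComp (g 1) (f 0)).symm ≪≫ cokernelIsoOfEq h10.symm⟩

lemma isGorensteinProjective_of_mem {𝒮 : ModuleCat.{u} R → Prop}
    (hl : ∀ M, 𝒮 M → ∃ K, 𝒮 K ∧ IsTotalSyzygy K M)
    (hr : ∀ M, 𝒮 M → ∃ C, 𝒮 C ∧ IsTotalSyzygy M C) {M : ModuleCat.{u} R} (hM : 𝒮 M) :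
    IsGorensteinProjective M := by
  obtain ⟨N, rfl, hN⟩ := exists_int_syzygies hl hr hM
  exact isGorensteinProjective_of_syzygies hN

lemma isTotalSyzygy_zero_left (P : ModuleCat.{u} R) (hP : Projective P) :
    IsTotalSyzygy (ModuleCat.of R PUnit.{u + 1}) P := by
  have hz : IsZero (ModuleCat.of R PUnit.{u + 1}) := ModuleCat.isZero_of_subsingleton _
  have : Mono (0 : ModuleCat.of R PUnit.{u + 1} ⟶ P) := ⟨fun _ _ _ => hz.eq_of_tgt _ _⟩
  refine ⟨P, 0, 𝟙 P, zero_comp, hP, ⟨?_⟩, fun Q _ φ => ⟨0, hz.eq_of_src _ _⟩⟩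
  exact (ShortComplex.exact_iff_mono _ rfl).2 (inferInstanceAs (Mono (𝟙 P)))

lemma isTotalSyzygy_zero_right (P : ModuleCat.{u} R) (hP : Projective P) :
    IsTotalSyzygy P (ModuleCat.of R PUnit.{u + 1}) := by
  have hz : IsZero (ModuleCat.of R PUnit.{u + 1}) := ModuleCat.isZero_of_subsingleton _
  have : Epi (0 : P ⟶ ModuleCat.of R PUnit.{u + 1}) := ⟨fun _ _ _ => hz.eq_of_src _ _⟩
  refine ⟨P, 𝟙 P, 0, comp_zero, hP, ⟨?_⟩, fun Q _ φ => ⟨φ, Category.id_comp _⟩⟩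
  exact (ShortComplex.exact_iff_epi _ rfl).2 (inferInstanceAs (Epi (𝟙 P)))

lemma isGorensteinProjective_of_projective {P : ModuleCat.{u} R} (hP : Projective P) :
    IsGorensteinProjective P := by
  have hz : Projective (ModuleCat.of R PUnit.{u + 1}) :=
    (ModuleCat.isZero_of_subsingleton _).projective
  exact isGorensteinProjective_of_mem (𝒮 := fun P => Projective P)
    (fun P hP => ⟨_, hz, isTotalSyzygy_zero_left P hP⟩)
    (fun P hP => ⟨_, hz, isTotalSyzygy_zero_right P hP⟩) hP

/-- A complex of projective modules is totally acyclic. -/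
def IsTotallyAcyclic (C : ChainComplex (ModuleCat.{u} R) ℤ) : Prop :=
  (∀ i, Projective (C.X i)) ∧ (∀ i, C.ExactAt i) ∧
    ∀ P : ModuleCat.{u} R, Projective P →
      ∀ (i : ℤ) (f : C.X i ⟶ P), C.d (i + 1) i ≫ f = 0 →
        ∃ g : C.X (i - 1) ⟶ P, f = C.d i (i - 1) ≫ g

lemma IsTotallyAcyclic.isTotalSyzygy {C : ChainComplex (ModuleCat.{u} R) ℤ}
    (hC : IsTotallyAcyclic C) (i : ℤ) :
    IsTotalSyzygy (cokernel (C.d (i + 1 + 1) (i + 1))) (cokernel (C.d (i + 1) i)) := by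
  obtain ⟨hP, hex, hQ⟩ := hC
  have hdd := C.d_comp_d (i + 1 + 1) (i + 1) i
  have hm : Mono (cokernel.desc _ _ hdd) :=
    ((chainComplex_exactAt_iff C _ _ _ rfl rfl).1 (hex (i + 1))).mono_cokernelDesc
  have w : cokernel.desc _ _ hdd ≫ cokernel.π (C.d (i + 1) i) = 0 := by
    rw [← cancel_epi (cokernel.π _), cokernel.π_desc_assoc, cokernel.condition, comp_zero]
  refine ⟨C.X i, cokernel.desc _ _ hdd, cokernel.π _, w, hP i, ?_, fun Q hQ' φ => ?_⟩
  · have h1 := ShortComplex.cokernelSequence_exact (C.d (i + 1) i)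
    let τ : ShortComplex.cokernelSequence (C.d (i + 1) i) ⟶ ShortComplex.mk _ _ w :=
      { τ₁ := cokernel.π _, τ₂ := 𝟙 _, τ₃ := 𝟙 _
        comm₁₂ := (cokernel.π_desc _ _ _).trans (Category.comp_id _).symm
        comm₂₃ := (Category.id_comp _).trans (Category.comp_id _).symm }
    have eπ : Epi (cokernel.π (C.d (i + 1 + 1) (i + 1))) := inferInstance
    have : Epi τ.τ₁ := eπ
    have : IsIso τ.τ₂ := inferInstanceAs (IsIso (𝟙 _))
    have : Mono τ.τ₃ := inferInstanceAs (Mono (𝟙 _))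
    have : Epi (ShortComplex.mk _ _ w).g := inferInstanceAs (Epi (cokernel.π _))
    exact ⟨(ShortComplex.exact_iff_of_epi_of_isIso_of_mono τ).1 h1⟩
  · obtain ⟨ψ, hψ⟩ : ∃ ψ : C.X i ⟶ Q, cokernel.π _ ≫ φ = C.d (i + 1) i ≫ ψ := by
      have key : ∀ j, j = i + 1 - 1 → (∃ ψ : C.X j ⟶ Q, cokernel.π _ ≫ φ = C.d (i + 1) j ≫ ψ) := by
        rintro _ rfl
        exact hQ Q hQ' (i + 1) (cokernel.π _ ≫ φ) (by rw [cokernel.condition_assoc, zero_comp])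
      exact key i (by omega)
    refine ⟨ψ, ?_⟩
    rw [← cancel_epi (cokernel.π _), hψ]
    exact cokernel.π_desc_assoc _ _ _ _

lemma IsTotalSyzygy.biprod_right {A B : ModuleCat.{u} R} (h : IsTotalSyzygy A B)
    {Q : ModuleCat.{u} R} (hQ : Projective Q) : IsTotalSyzygy A (B ⊞ Q) := by
  obtain ⟨P, f, g, w, hP, hS, hE⟩ := h
  have mf : Mono f := hS.mono_f
  have eg : Epi g := hS.epi_g
  have w' : (f ≫ biprod.inl : A ⟶ P ⊞ Q) ≫ biprod.map g (𝟙 Q) = 0 := by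
    rw [Category.assoc, biprod.inl_map, reassoc_of% w, zero_comp]
  refine ⟨P ⊞ Q, f ≫ biprod.inl, biprod.map g (𝟙 Q), w', inferInstance, ?_, fun T hT φ => ?_⟩
  · have : Mono (ShortComplex.mk _ _ w').f := inferInstanceAs (Mono (f ≫ biprod.inl))
    have : Epi (ShortComplex.mk _ _ w').g := inferInstanceAs (Epi (biprod.map g (𝟙 Q)))
    refine ⟨ShortComplex.exact_of_f_is_kernel _ (KernelFork.IsLimit.ofι' _ _ fun {T} k hk => ?_)⟩
    replace hk : k ≫ biprod.map g (𝟙 Q) = 0 := hk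
    have h1 : (k ≫ biprod.fst) ≫ g = 0 := by
      rw [Category.assoc, ← biprod.map_fst g (𝟙 Q), reassoc_of% hk, zero_comp]
    have h2 : k ≫ biprod.snd = 0 := by
      rw [← Category.comp_id biprod.snd, ← biprod.map_snd g (𝟙 Q), reassoc_of% hk, zero_comp]
    refine ⟨hS.exact.lift (k ≫ biprod.fst) h1, ?_⟩
    have h3 : hS.exact.lift (k ≫ biprod.fst) h1 ≫ f = k ≫ biprod.fst := hS.exact.lift_f _ _
    dsimp only
    rw [reassoc_of% h3]
    apply biprod.hom_ext <;> simp [h2]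
  · obtain ⟨ψ, hψ⟩ := hE T hT φ
    replace hψ : f ≫ ψ = φ := hψ
    exact ⟨biprod.desc ψ 0, by simp [hψ]⟩

lemma IsTotalSyzygy.biprod_left {A B : ModuleCat.{u} R} (h : IsTotalSyzygy A B)
    {Q : ModuleCat.{u} R} (hQ : Projective Q) : IsTotalSyzygy (A ⊞ Q) B := by
  obtain ⟨P, f, g, w, hP, hS, hE⟩ := h
  have mf : Mono f := hS.mono_f
  have eg : Epi g := hS.epi_g
  have w' : biprod.map f (𝟙 Q) ≫ (biprod.fst ≫ g : P ⊞ Q ⟶ B) = 0 := by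
    rw [biprod.map_fst_assoc, w, comp_zero]
  refine ⟨P ⊞ Q, biprod.map f (𝟙 Q), biprod.fst ≫ g, w', inferInstance, ?_, fun T hT φ => ?_⟩
  · have : Mono (ShortComplex.mk _ _ w').f := inferInstanceAs (Mono (biprod.map f (𝟙 Q)))
    have : Epi (ShortComplex.mk _ _ w').g := inferInstanceAs (Epi (biprod.fst ≫ g))
    refine ⟨ShortComplex.exact_of_f_is_kernel _ (KernelFork.IsLimit.ofι' _ _ fun {T} k hk => ?_)⟩
    replace hk : k ≫ (biprod.fst ≫ g : P ⊞ Q ⟶ B) = 0 := hk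
    rw [← Category.assoc] at hk
    have h3 : hS.exact.lift (k ≫ biprod.fst) hk ≫ f = k ≫ biprod.fst := hS.exact.lift_f _ _
    refine ⟨biprod.lift (hS.exact.lift (k ≫ biprod.fst) hk) (k ≫ biprod.snd), ?_⟩
    dsimp only
    apply biprod.hom_ext <;> simp [h3]
  · obtain ⟨ψ, hψ⟩ := hE T hT (biprod.inl ≫ φ)
    replace hψ : f ≫ ψ = biprod.inl ≫ φ := hψ
    refine ⟨biprod.desc ψ (biprod.inr ≫ φ), ?_⟩
    apply biprod.hom_ext' <;> simp [hψ]

/-- A syzygy of a retract of `X` is a retract of `K ⊞ P` with `K` a syzygy of `X`. -/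
lemma IsTotalSyzygy.retract_right {K X M : ModuleCat.{u} R} (h : IsTotalSyzygy K X)
    (ρ : Retract M X) :
    ∃ (L P : ModuleCat.{u} R), Projective P ∧ Nonempty (Retract L (K ⊞ P)) ∧
      IsTotalSyzygy L M := by
  obtain ⟨P, j, k, w, hP, hS, hE⟩ := h
  have mj : Mono j := hS.mono_f
  have ek : Epi k := hS.epi_g
  obtain ⟨e, he⟩ : ∃ e : P ⟶ P, e ≫ k = (k ≫ ρ.r) ≫ ρ.i :=
    ⟨_, Projective.factorThru_comp ((k ≫ ρ.r) ≫ ρ.i) k⟩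
  have hl : kernel.ι (k ≫ ρ.r) ≫ k ≫ ρ.r = 0 := kernel.condition _
  generalize hL : kernel.ι (k ≫ ρ.r) = l at hl
  have h1 : (l ≫ e) ≫ k = 0 := by
    rw [Category.assoc, he, ← Category.assoc, hl, zero_comp]
  obtain ⟨e', he'⟩ : ∃ e', e' ≫ j = l ≫ e := ⟨hS.exact.lift (l ≫ e) h1, hS.exact.lift_f _ _⟩
  have hj : j ≫ k ≫ ρ.r = 0 := by rw [reassoc_of% w, zero_comp]
  have hx : (𝟙 P - e) ≫ k ≫ ρ.r = 0 := by
    simp [Preadditive.sub_comp, reassoc_of% he]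
  obtain ⟨t₁, ht₁⟩ : ∃ t, t ≫ l = j := ⟨kernel.lift _ j hj, by rw [← hL, kernel.lift_ι]⟩
  obtain ⟨t₂, ht₂⟩ : ∃ t, t ≫ l = 𝟙 P - e := ⟨kernel.lift _ _ hx, by rw [← hL, kernel.lift_ι]⟩
  have ml : Mono l := hL ▸ inferInstance
  have hst : e' ≫ t₁ + l ≫ t₂ = 𝟙 _ := by
    rw [← cancel_mono l]
    simp [Preadditive.add_comp, ht₁, ht₂, he', Preadditive.comp_sub]
  refine ⟨_, P, hP, ⟨⟨biprod.lift e' l, biprod.desc t₁ t₂, by simpa using hst⟩⟩,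
    P, l, k ≫ ρ.r, hl, hP, ?_, fun Q hQ φ => ?_⟩
  · have er : Epi ρ.r := inferInstance
    have : Mono (ShortComplex.mk _ _ hl).f := ml
    have : Epi (ShortComplex.mk _ _ hl).g := inferInstanceAs (Epi (k ≫ ρ.r))
    subst hL
    exact ⟨ShortComplex.exact_of_f_is_kernel _ (kernelIsKernel _)⟩
  · obtain ⟨ψ, hψ⟩ := hE Q hQ (t₁ ≫ φ)
    replace hψ : j ≫ ψ = t₁ ≫ φ := hψ
    refine ⟨e ≫ ψ + t₂ ≫ φ, ?_⟩
    change l ≫ (e ≫ ψ + t₂ ≫ φ) = φ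
    rw [Preadditive.comp_add, ← reassoc_of% he', hψ, ← Category.assoc, ← Category.assoc,
      ← Preadditive.add_comp, hst, Category.id_comp]

/-- A cosyzygy of a retract of `X` is a retract of `K ⊞ P` with `K` a cosyzygy of `X`. -/
lemma IsTotalSyzygy.retract_left {K X M : ModuleCat.{u} R} (h : IsTotalSyzygy X K)
    (ρ : Retract M X) :
    ∃ (L P : ModuleCat.{u} R), Projective P ∧ Nonempty (Retract L (K ⊞ P)) ∧
      IsTotalSyzygy M L := by
  obtain ⟨P, j, p, w, hP, hS, hE⟩ := h
  have mj : Mono j := hS.mono_f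
  have ep : Epi p := hS.epi_g
  obtain ⟨e, he⟩ : ∃ e : P ⟶ P, j ≫ e = ρ.r ≫ ρ.i ≫ j := hE P hP _
  have hq : (ρ.i ≫ j) ≫ cokernel.π (ρ.i ≫ j) = 0 := cokernel.condition _
  generalize hC : cokernel.π (ρ.i ≫ j) = q at hq
  have eq : Epi q := hC ▸ inferInstance
  have h1 : j ≫ e ≫ q = 0 := by
    rw [reassoc_of% he, ← Category.assoc ρ.i, hq, comp_zero]
  obtain ⟨t, ht⟩ : ∃ t, p ≫ t = e ≫ q := ⟨hS.exact.desc (e ≫ q) h1, hS.exact.g_desc _ _⟩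
  have hp : (ρ.i ≫ j) ≫ p = 0 := by rw [Category.assoc, w, comp_zero]
  have hx : (ρ.i ≫ j) ≫ (𝟙 P - e) = 0 := by
    simp [Preadditive.comp_sub, he]
  obtain ⟨s₁, hs₁⟩ : ∃ s, q ≫ s = p := ⟨cokernel.desc _ p hp, by rw [← hC, cokernel.π_desc]⟩
  obtain ⟨s₂, hs₂⟩ : ∃ s, q ≫ s = 𝟙 P - e :=
    ⟨cokernel.desc _ _ hx, by rw [← hC, cokernel.π_desc]⟩
  have hst : s₁ ≫ t + s₂ ≫ q = 𝟙 _ := by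
    rw [← cancel_epi q]
    simp [Preadditive.comp_add, reassoc_of% hs₁, reassoc_of% hs₂, ht, Preadditive.sub_comp]
  refine ⟨_, P, hP, ⟨⟨biprod.lift s₁ s₂, biprod.desc t q, by simpa using hst⟩⟩,
    P, ρ.i ≫ j, q, hq, hP, ?_, fun Q hQ φ => ?_⟩
  · have mi : Mono ρ.i := inferInstance
    have : Mono (ShortComplex.mk _ _ hq).f := inferInstanceAs (Mono (ρ.i ≫ j))
    have : Epi (ShortComplex.mk _ _ hq).g := eq
    subst hC
    exact ⟨ShortComplex.exact_of_g_is_cokernel _ (cokernelIsCokernel _)⟩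
  · obtain ⟨ψ, hψ⟩ := hE Q hQ (ρ.r ≫ φ)
    replace hψ : j ≫ ψ = ρ.r ≫ φ := hψ
    refine ⟨ψ, ?_⟩
    change (ρ.i ≫ j) ≫ ψ = φ
    rw [Category.assoc, hψ, ρ.retract_assoc]

/-- Gorenstein projective modules are closed under retracts. -/
lemma IsGorensteinProjective.of_retract {G M : ModuleCat.{u} R} (hG : IsGorensteinProjective G)
    (ρ : Retract M G) : IsGorensteinProjective M := by
  obtain ⟨C, hP, hex, ⟨ε⟩, hQ⟩ := hG
  have hC : IsTotallyAcyclic C := ⟨hP, hex, hQ⟩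
  obtain ⟨ε⟩ : Nonempty (G ≅ cokernel (C.d (0 + 1) 0)) := by
    rw [zero_add]
    exact ⟨ε⟩
  refine isGorensteinProjective_of_mem (𝒮 := fun M => ∃ (i : ℤ) (Q : ModuleCat.{u} R),
    Projective Q ∧ Nonempty (Retract M (cokernel (C.d (i + 1) i) ⊞ Q))) ?_ ?_
    ⟨0, ModuleCat.of R PUnit, (ModuleCat.isZero_of_subsingleton _).projective,
      ⟨ρ.trans ⟨ε.hom ≫ biprod.inl, biprod.fst ≫ ε.inv, ?_⟩⟩⟩
  · rintro M ⟨i, Q, hQ, ⟨ρ⟩⟩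
    obtain ⟨L, P, hP, hL, h⟩ := ((hC.isTotalSyzygy i).biprod_right hQ).retract_right ρ
    exact ⟨L, ⟨i + 1, P, hP, hL⟩, h⟩
  · rintro M ⟨i, Q, hQ, ⟨ρ⟩⟩
    obtain ⟨k, rfl⟩ : ∃ k, i = k + 1 := ⟨i - 1, by omega⟩
    obtain ⟨L, P, hP, hL, h⟩ := ((hC.isTotalSyzygy k).biprod_left hQ).retract_left ρ
    exact ⟨L, ⟨k, P, hP, hL⟩, h⟩
  · simp

/-- Vanishing of `Ext¹` in terms of a projective resolution. -/
lemma extVanish_one_iff {M N : ModuleCat.{u} R} (P : ProjectiveResolution M) :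
    extVanish 1 M N ↔ ∀ f : P.complex.X 1 ⟶ N, P.complex.d 2 1 ≫ f = 0 →
      ∃ g : P.complex.X 0 ⟶ N, P.complex.d 1 0 ≫ g = f := by
  have h1 : extVanish 1 M N ↔ (P.complex.linearYonedaObj R N).ExactAt 1 := by
    rw [HomologicalComplex.exactAt_iff_isZero_homology, ← (P.isoExt 1 N).isZero_iff]
    exact ModuleCat.isZero_iff_subsingleton.symm
  rw [h1, HomologicalComplex.exactAt_iff' _ 0 1 2 (by simp) (by simp),
    ShortComplex.moduleCat_exact_iff]
  rfl

/-- If `Ext¹(Q, N) = 0` then maps from `Q` lift along epimorphisms with kernel `N`. -/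
lemma exists_lift_of_extVanish {Q : ModuleCat.{u} R} {S : ShortComplex (ModuleCat.{u} R)}
    (hS : S.ShortExact) (h : extVanish 1 Q S.X₁) (φ : Q ⟶ S.X₃) :
    ∃ ψ : Q ⟶ S.X₂, ψ ≫ S.g = φ := by
  have := hS.mono_f
  have := hS.epi_g
  let P := projectiveResolution Q
  rw [extVanish_one_iff P] at h
  let π : P.complex.X 0 ⟶ Q := P.π.f 0
  have eπ : Epi π := inferInstanceAs (Epi (P.π.f 0))
  have hdπ : P.complex.d 1 0 ≫ π = 0 := P.complex_d_comp_π_f_zero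
  obtain ⟨e, he⟩ : ∃ e, e ≫ S.g = π ≫ φ := ⟨_, Projective.factorThru_comp (π ≫ φ) S.g⟩
  have h0 : (P.complex.d 1 0 ≫ e) ≫ S.g = 0 := by
    rw [Category.assoc, he, reassoc_of% hdπ, zero_comp]
  obtain ⟨c, hc⟩ : ∃ c, c ≫ S.f = P.complex.d 1 0 ≫ e :=
    ⟨hS.exact.lift _ h0, hS.exact.lift_f _ _⟩
  obtain ⟨c', hc'⟩ := h c (by
    rw [← cancel_mono S.f, Category.assoc, hc, P.complex.d_comp_d_assoc, zero_comp, zero_comp])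
  have h2 : P.complex.d 1 0 ≫ (e - c' ≫ S.f) = 0 := by
    rw [Preadditive.comp_sub, reassoc_of% hc', hc, sub_self]
  have hex : (ShortComplex.mk _ _ hdπ).Exact := P.exact₀
  have : Epi (ShortComplex.mk _ _ hdπ).g := eπ
  obtain ⟨ψ, hψ⟩ : ∃ ψ, π ≫ ψ = e - c' ≫ S.f := ⟨hex.desc _ h2, hex.g_desc _ _⟩
  refine ⟨ψ, ?_⟩
  rw [← cancel_epi π, reassoc_of% hψ]
  simp [Preadditive.sub_comp, he]

/-- If every extension of `M` by `N` splits then `Ext¹(M, N) = 0`. -/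
lemma extVanish_of_splits {M N : ModuleCat.{u} R}
    (h : ∀ (E : ModuleCat.{u} R) (f : N ⟶ E) (g : E ⟶ M) (w : f ≫ g = 0),
      (ShortComplex.mk f g w).ShortExact → ∃ s : M ⟶ E, s ≫ g = 𝟙 M) :
    extVanish 1 M N := by
  let P := projectiveResolution M
  rw [extVanish_one_iff P]
  intro c hc
  let π : P.complex.X 0 ⟶ M := P.π.f 0
  have eπ : Epi π := inferInstanceAs (Epi (P.π.f 0))
  have hdπ : P.complex.d 1 0 ≫ π = 0 := P.complex_d_comp_π_f_zero
  have hex : (ShortComplex.mk _ _ hdπ).Exact := P.exact₀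
  let k : P.complex.X 1 ⟶ kernel π := kernel.lift π _ hdπ
  have hk : k ≫ kernel.ι π = P.complex.d 1 0 := kernel.lift_ι _ _ _
  have ek : Epi k := (ShortComplex.exact_iff_epi_kernel_lift _).1 hex
  have hdk : P.complex.d 2 1 ≫ k = 0 := by
    rw [← cancel_mono (kernel.ι π), Category.assoc, hk, P.complex.d_comp_d, zero_comp]
  have hex₁ : (ShortComplex.mk _ _ hdk).Exact := by
    let τ : ShortComplex.mk _ _ hdk ⟶ ShortComplex.mk _ _ (P.complex.d_comp_d 2 1 0) :=
      { τ₁ := 𝟙 _, τ₂ := 𝟙 _, τ₃ := kernel.ι π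
        comm₁₂ := (Category.id_comp _).trans (Category.comp_id _).symm
        comm₂₃ := (Category.id_comp _).trans hk.symm }
    have : Epi τ.τ₁ := inferInstanceAs (Epi (𝟙 _))
    have : IsIso τ.τ₂ := inferInstanceAs (IsIso (𝟙 _))
    have : Mono τ.τ₃ := inferInstanceAs (Mono (kernel.ι π))
    exact (ShortComplex.exact_iff_of_epi_of_isIso_of_mono τ).2 (P.exact_succ 0)
  have : Epi (ShortComplex.mk _ _ hdk).g := ek
  obtain ⟨c', hc'⟩ : ∃ c', k ≫ c' = c := ⟨hex₁.desc c hc, hex₁.g_desc _ _⟩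
  have hg0 : c' ≫ (0 : N ⟶ M) = kernel.ι π ≫ π := by rw [kernel.condition, comp_zero]
  let inl : N ⟶ pushout c' (kernel.ι π) := pushout.inl _ _
  let inr : P.complex.X 0 ⟶ pushout c' (kernel.ι π) := pushout.inr _ _
  have hpo : c' ≫ inl = kernel.ι π ≫ inr := pushout.condition
  let g : pushout c' (kernel.ι π) ⟶ M := pushout.desc 0 π hg0
  have hg₁ : inl ≫ g = 0 := pushout.inl_desc _ _ _
  have hg₂ : inr ≫ g = π := pushout.inr_desc _ _ _
  have minl : Mono inl := inferInstanceAs (Mono (pushout.inl _ _))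
  have eg : Epi g := epi_of_epi_fac hg₂
  have hSE : (ShortComplex.mk _ _ hg₁).ShortExact := by
    have : Mono (ShortComplex.mk _ _ hg₁).f := minl
    have : Epi (ShortComplex.mk _ _ hg₁).g := eg
    refine ⟨ShortComplex.exact_of_g_is_cokernel _
      (CokernelCofork.IsColimit.ofπ' _ _ fun {T} a ha => ?_)⟩
    replace ha : inl ≫ a = 0 := ha
    have h3 : P.complex.d 1 0 ≫ inr ≫ a = 0 := by
      rw [← hk, Category.assoc, ← reassoc_of% hpo, ha, comp_zero, comp_zero]
    have : Epi (ShortComplex.mk _ _ hdπ).g := eπ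
    have h4 : π ≫ hex.desc _ h3 = inr ≫ a := hex.g_desc _ _
    refine ⟨hex.desc _ h3, pushout.hom_ext ?_ ?_⟩
    · change inl ≫ g ≫ _ = inl ≫ a
      rw [reassoc_of% hg₁, zero_comp, ha]
    · change inr ≫ g ≫ _ = inr ≫ a
      rw [reassoc_of% hg₂, h4]
  obtain ⟨s, hs⟩ := h _ inl g hg₁ hSE
  have h5 : (𝟙 _ - g ≫ s) ≫ g = 0 := by
    simp [Preadditive.sub_comp, hs]
  obtain ⟨r, hr⟩ : ∃ r, r ≫ inl = 𝟙 _ - g ≫ s :=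
    ⟨hSE.exact.lift _ h5, hSE.exact.lift_f _ _⟩
  have hir : inl ≫ r = 𝟙 N := by
    rw [← cancel_mono inl, Category.assoc, hr]
    simp [Preadditive.comp_sub, reassoc_of% hg₁]
  refine ⟨inr ≫ r, ?_⟩
  rw [← hk, Category.assoc, ← reassoc_of% hpo, hir, Category.comp_id, hc']

/-- If every module in `^⊥(GP^⊥)` admits a Gorenstein projective precover,
then the Gorenstein projective modules are exactly the `GP`-pure projective modules. -/
theorem stmt5 {R : Type u} [CommRing R]
    (h : ∀ M : ModuleCat.{u} R,
      (∀ N : ModuleCat.{u} R, MemGPperp N → extVanish 1 M N) →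
      ∃ (G : ModuleCat.{u} R) (φ : G ⟶ M), IsGPPrecover φ) :
    ∀ M : ModuleCat.{u} R, IsGorensteinProjective M ↔ GPPureProjective M := by
  refine fun M => ⟨fun hM S _ hp φ => hp M hM φ, fun hM => ?_⟩
  obtain ⟨G, φ, hG, hφ⟩ := h M fun N hN => extVanish_of_splits fun E f g w hS =>
    hM _ hS (fun U hU => exists_lift_of_extVanish hS (hN U hU)) (𝟙 M)
  have eφ : Epi φ := by
    obtain ⟨χ, hχ⟩ := hφ _ (isGorensteinProjective_of_projective (Projective.projective_over M))
      (Projective.π M)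
    exact epi_of_epi_fac hχ
  have hS : (ShortComplex.mk (kernel.ι φ) φ (kernel.condition φ)).ShortExact := by
    have : Mono (ShortComplex.mk _ _ (kernel.condition φ)).f := inferInstanceAs (Mono (kernel.ι φ))
    have : Epi (ShortComplex.mk _ _ (kernel.condition φ)).g := eφ
    exact ⟨ShortComplex.exact_of_f_is_kernel _ (kernelIsKernel φ)⟩
  obtain ⟨s, hs⟩ := hM _ hS hφ (𝟙 M)
  exact hG.of_retract ⟨s, φ, hs⟩
end

section
/- Let R be a commutative coherent ring. If the class of GP-pure injective R-modules coincides with the class of Gorenstein injective R-modules, then the class of GP-pure flat R-modules coincides with the class of Gorenstein flat R-modules. -/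
open CategoryTheory Opposite Limits MonoidalCategory

universe u

variable {R : Type u} [CommRing R]

section CharacterModule

variable {A B D : Type*} [AddCommGroup A] [AddCommGroup B] [AddCommGroup D]
  [Module R A] [Module R B] [Module R D]

theorem CharacterModule.dual_exact {f : A →ₗ[R] B} {g : B →ₗ[R] D} (h : Function.Exact f g) :
    Function.Exact (CharacterModule.dual g) (CharacterModule.dual f) := by
  intro χ
  constructor
  · intro hχ
    have hχ' : ∀ b, g b = 0 → χ b = 0 := fun b hb => by
      obtain ⟨a, rfl⟩ := (h b).1 hb
      exact DFunLike.congr_fun hχ a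
    let g' : B →+ LinearMap.range g := g.rangeRestrict.toAddMonoidHom
    have hg' : Function.Surjective g' := g.surjective_rangeRestrict
    let ψ : CharacterModule (LinearMap.range g) :=
      AddMonoidHom.liftOfSurjective g' hg' ⟨χ, fun b hb => hχ' b (congrArg Subtype.val hb)⟩
    obtain ⟨θ, hθ⟩ := CharacterModule.dual_surjective_of_injective
      (LinearMap.range g).subtype (Submodule.injective_subtype _) ψ
    refine ⟨θ, ?_⟩
    ext b
    have h1 : θ (g b) = ψ (g' b) := DFunLike.congr_fun hθ (g' b)
    have h2 : ψ (g' b) = χ b :=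
      AddMonoidHom.liftOfRightInverse_comp_apply g' _ (Function.rightInverse_surjInv hg')
        ⟨χ, fun b hb => hχ' b (congrArg Subtype.val hb)⟩ b
    exact h1.trans h2
  · rintro ⟨ψ, rfl⟩
    ext a
    have : ψ (g (f a)) = 0 := by rw [h.apply_apply_eq_zero]; exact map_zero ψ
    exact this

theorem CharacterModule.dual_apply_apply (f : A →ₗ[R] B) (c : CharacterModule B) (a : A) :
    CharacterModule.dual f c a = c (f a) := rfl

theorem CharacterModule.curry_dual_lTensor (g : B →ₗ[R] D) (s : A →ₗ[R] CharacterModule D) :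
    CharacterModule.curry (CharacterModule.dual (g.lTensor A) (CharacterModule.uncurry s)) =
      CharacterModule.dual g ∘ₗ s := by
  ext a b
  rfl

theorem CharacterModule.curry_uncurry (s : A →ₗ[R] CharacterModule D) :
    CharacterModule.curry (CharacterModule.uncurry s) = s := by
  ext a b
  rfl

theorem CharacterModule.curry_injective :
    Function.Injective (CharacterModule.curry (R := R) (A := A) (B := D)) :=
  CharacterModule.homEquiv.symm.injective

theorem CharacterModule.uncurry_curry (c : CharacterModule (TensorProduct R A D)) :
    CharacterModule.uncurry (CharacterModule.curry (R := R) c) = c :=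
  CharacterModule.curry_injective (CharacterModule.curry_uncurry _)

theorem CharacterModule.lTensor_injective_of_lifts {g : B →ₗ[R] D}
    (h : ∀ t : A →ₗ[R] CharacterModule B, ∃ s : A →ₗ[R] CharacterModule D,
      CharacterModule.dual g ∘ₗ s = t) :
    Function.Injective (g.lTensor A) := by
  rw [← CharacterModule.dual_surjective_iff_injective]
  intro c
  obtain ⟨s, hs⟩ := h (CharacterModule.curry c)
  exact ⟨CharacterModule.uncurry s, CharacterModule.curry_injective
    ((CharacterModule.curry_dual_lTensor g s).trans hs)⟩

end CharacterModule

theorem Module.Injective.exists_extend_of_exact {A B D E : Type u} [AddCommGroup A]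
    [AddCommGroup B] [AddCommGroup D] [AddCommGroup E] [Module R A] [Module R B] [Module R D]
    [Module R E] [Module.Injective R E] {f : A →ₗ[R] B} {g : B →ₗ[R] D}
    (h : Function.Exact f g) (t : B →ₗ[R] E) (ht : t ∘ₗ f = 0) :
    ∃ s : D →ₗ[R] E, s ∘ₗ g = t := by
  have hker : LinearMap.ker g ≤ LinearMap.ker t := fun b hb => by
    obtain ⟨a, rfl⟩ := (h b).1 hb
    exact LinearMap.congr_fun ht a
  obtain ⟨s, hs⟩ := Module.Injective.out ((LinearMap.ker g).liftQ g le_rfl)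
    (LinearMap.ker_eq_bot.1 (Submodule.ker_liftQ_eq_bot _ _ _ le_rfl))
    ((LinearMap.ker g).liftQ t hker)
  exact ⟨s, LinearMap.ext fun b => hs (Submodule.Quotient.mk b)⟩

/-- Over a coherent ring the character module of an injective module is flat. -/
theorem IsCoherentRing.flat_characterModule (hcoh : IsCoherentRing R) (E : Type u)
    [AddCommGroup E] [Module R E] [Module.Injective R E] : Module.Flat R (CharacterModule E) := by
  refine Module.Flat.of_forall_isTrivialRelation fun {l f φ} hφ => ?_
  let α : (Fin l → R) →ₗ[R] R := Fintype.linearCombination R f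
  have hfp : Module.FinitePresentation R (LinearMap.range α) :=
    hcoh _ (Module.Finite.iff_fg.1 inferInstance)
  have hfg : (LinearMap.ker α).FG := by
    rw [← LinearMap.ker_rangeRestrict]
    exact Module.FinitePresentation.fg_ker _ α.surjective_rangeRestrict
  have : Module.Finite R (LinearMap.ker α) := Module.Finite.iff_fg.2 hfg
  obtain ⟨m, β', hβ'⟩ := Module.Finite.exists_fin' R (LinearMap.ker α)
  let β : (Fin m → R) →ₗ[R] (Fin l → R) := (LinearMap.ker α).subtype ∘ₗ β'
  have hβ : Function.Exact β α := by
    refine hβ'.comp_exact_iff_exact.2 ?_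
    rw [LinearMap.exact_iff, Submodule.range_subtype]
  have hex : Function.Exact (α.lcomp R E) (β.lcomp R E) := by
    intro t
    constructor
    · intro ht
      obtain ⟨s, hs⟩ := Module.Injective.exists_extend_of_exact hβ t ht
      exact ⟨s, hs⟩
    · rintro ⟨s, rfl⟩
      ext x
      simp [hβ.apply_apply_eq_zero]
  have hex' := CharacterModule.dual_exact hex
  have sum_apply : ∀ {X : Type u} [AddCommGroup X] {ι : Type} (s : Finset ι)
      (c : ι → CharacterModule X) (x : X), (∑ i ∈ s, c i) x = ∑ i ∈ s, c i x :=
    fun s c x => map_sum (⟨⟨fun c : CharacterModule _ => c x, rfl⟩, fun _ _ => rfl⟩ :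
      CharacterModule _ →+ AddCircle (1 : ℚ)) c s
  let Φ : CharacterModule ((Fin l → R) →ₗ[R] E) :=
    ∑ i, CharacterModule.dual (LinearMap.applyₗ (Pi.single i 1 : Fin l → R)) (φ i)
  have hΦ : ∀ t, Φ t = ∑ i, φ i (t (Pi.single i 1)) := fun t => sum_apply _ _ _
  have hΦ0 : CharacterModule.dual (α.lcomp R E) Φ = 0 := by
    ext t
    have h1 : ∀ i, φ i (t (f i)) = (f i • φ i) (t 1) := fun i => by
      rw [CharacterModule.smul_apply, ← map_smul, smul_eq_mul, mul_one]
    calc Φ (α.lcomp R E t) = ∑ i, φ i (t (f i)) := by simp [hΦ, α]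
      _ = (∑ i, f i • φ i) (t 1) := by rw [sum_apply]; simp only [h1]
      _ = 0 := by rw [hφ]; rfl
  obtain ⟨Ψ, hΨ⟩ := (hex' Φ).1 hΦ0
  refine ⟨m, fun i j => β (Pi.single j 1) i, fun j => CharacterModule.dual
    (LinearMap.smulRightₗ (LinearMap.proj j : (Fin m → R) →ₗ[R] R)) Ψ, fun i => ?_, fun j => ?_⟩
  · ext e
    have h1 : φ i e = Φ ((LinearMap.proj i : (Fin l → R) →ₗ[R] R).smulRight e) := by
      rw [hΦ, Finset.sum_eq_single i]
      · simp
      · intro k _ hk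
        simp [hk.symm]
      · simp
    have h2 : ((LinearMap.proj i : (Fin l → R) →ₗ[R] R).smulRight e) ∘ₗ β =
        ∑ j, (LinearMap.proj j : (Fin m → R) →ₗ[R] R).smulRight (β (Pi.single j 1) i • e) := by
      refine LinearMap.pi_ext' fun j => LinearMap.ext_ring ?_
      simp [Pi.single_apply]
    rw [h1, ← hΨ, sum_apply]
    have h3 : ∀ j, (β (Pi.single j 1) i • CharacterModule.dual
        (LinearMap.smulRightₗ (LinearMap.proj j : (Fin m → R) →ₗ[R] R)) Ψ) e =
        Ψ ((LinearMap.proj j : (Fin m → R) →ₗ[R] R).smulRight (β (Pi.single j 1) i • e)) :=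
      fun j => rfl
    rw [Finset.sum_congr rfl fun j _ => h3 j, CharacterModule.dual_apply_apply]
    exact (congrArg Ψ h2).trans (map_sum Ψ _ _)
  · have := hβ.apply_apply_eq_zero (Pi.single j 1)
    simpa [α, Fintype.linearCombination_apply, mul_comm] using this

/-- The Pontryagin dual of a morphism of modules. -/
noncomputable def characterDualMap {M N : ModuleCat.{u} R} (f : M ⟶ N) :
    characterDual N ⟶ characterDual M :=
  ModuleCat.ofHom (CharacterModule.dual f.hom)

theorem characterDualMap_comp {L M N : ModuleCat.{u} R} (f : L ⟶ M) (g : M ⟶ N) :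
    characterDualMap (f ≫ g) = characterDualMap g ≫ characterDualMap f := rfl

theorem characterDualMap_zero (M N : ModuleCat.{u} R) :
    characterDualMap (0 : M ⟶ N) = 0 :=
  ModuleCat.hom_ext CharacterModule.dual_zero

/-- The Pontryagin dual of a short complex. -/
noncomputable def characterDualShortComplex (S : ShortComplex (ModuleCat.{u} R)) :
    ShortComplex (ModuleCat.{u} R) :=
  ShortComplex.mk (characterDualMap S.g) (characterDualMap S.f) (by
    rw [← characterDualMap_comp, S.zero, characterDualMap_zero])

theorem exact_characterDual {S : ShortComplex (ModuleCat.{u} R)} (hS : S.Exact) :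
    (characterDualShortComplex S).Exact := by
  rw [ShortComplex.ShortExact.moduleCat_exact_iff_function_exact] at hS ⊢
  exact CharacterModule.dual_exact hS

theorem shortExact_characterDual {S : ShortComplex (ModuleCat.{u} R)} (hS : S.ShortExact) :
    (characterDualShortComplex S).ShortExact where
  exact := exact_characterDual hS.exact
  mono_f := (ModuleCat.mono_iff_injective _).2
    (CharacterModule.dual_injective_of_surjective _ hS.moduleCat_surjective_g)
  epi_g := (ModuleCat.epi_iff_surjective _).2
    (CharacterModule.dual_surjective_of_injective _ hS.moduleCat_injective_f)

theorem xPureFlat_iff_xPureInjective_characterDual (𝒳 : ModuleCat.{u} R → Prop)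
    (M : ModuleCat.{u} R) : XPureFlat 𝒳 M ↔ XPureInjective 𝒳 (characterDual M) := by
  refine forall_congr' fun S => forall_congr' fun _ => forall_congr' fun _ => ?_
  change Function.Injective (S.f.hom.lTensor M) ↔ _
  rw [LinearMap.lTensor_inj_iff_rTensor_inj, rTensor_injective_iff_lcomp_surjective]
  constructor
  · intro h φ
    obtain ⟨ψ, hψ⟩ := h φ.hom
    exact ⟨ModuleCat.ofHom ψ, ModuleCat.hom_ext hψ⟩
  · intro h φ
    obtain ⟨ψ, hψ⟩ := h (ModuleCat.ofHom φ)
    exact ⟨ψ.hom, congrArg ModuleCat.Hom.hom hψ⟩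

theorem xPureInjective_of_injective (𝒳 : ModuleCat.{u} R → Prop) (E : ModuleCat.{u} R)
    [Injective E] : XPureInjective 𝒳 E := fun S hS _ φ =>
  have := hS.mono_f
  ⟨Injective.factorThru φ S.f, Injective.comp_factorThru φ S.f⟩

theorem XPureInjective.of_retract {𝒳 : ModuleCat.{u} R → Prop} {N G E : ModuleCat.{u} R}
    (hG : XPureInjective 𝒳 G) (hE : XPureInjective 𝒳 E) (a : N ⟶ G) (b : G ⟶ N)
    (i : N ⟶ E) (c : E ⟶ N) (h : a ≫ b + i ≫ c = 𝟙 N) : XPureInjective 𝒳 N := by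
  intro S hS hp φ
  obtain ⟨u, hu⟩ := hG S hS hp (φ ≫ a)
  obtain ⟨v, hv⟩ := hE S hS hp (φ ≫ i)
  refine ⟨u ≫ b + v ≫ c, ?_⟩
  rw [Preadditive.comp_add, ← Category.assoc, ← Category.assoc, hu, hv, Category.assoc,
    Category.assoc, ← Preadditive.comp_add, h, Category.comp_id]

/-- A Schanuel argument for kernels: two short exact sequences with the same right end which map
to each other over it. -/
theorem XPureInjective.of_shortExact_left {𝒳 : ModuleCat.{u} R → Prop}
    {S T : ShortComplex (ModuleCat.{u} R)} (hS : S.ShortExact) (hT : T.ShortExact)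
    (a : S.X₂ ⟶ T.X₂) (b : T.X₂ ⟶ S.X₂) (e : S.X₃ ≅ T.X₃)
    (ha : a ≫ T.g = S.g ≫ e.hom) (hb : b ≫ S.g = T.g ≫ e.inv)
    (hE : XPureInjective 𝒳 S.X₂) (hK : XPureInjective 𝒳 T.X₁) : XPureInjective 𝒳 S.X₁ := by
  have := hS.mono_f
  have := hT.mono_f
  obtain ⟨a', ha'⟩ : ∃ a' : S.X₁ ⟶ T.X₁, a' ≫ T.f = S.f ≫ a :=
    ⟨hT.exact.lift (S.f ≫ a) (by simp [ha]), hT.exact.lift_f _ _⟩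
  obtain ⟨b', hb'⟩ : ∃ b' : T.X₁ ⟶ S.X₁, b' ≫ S.f = T.f ≫ b :=
    ⟨hS.exact.lift (T.f ≫ b) (by simp [hb]), hS.exact.lift_f _ _⟩
  obtain ⟨c, hc⟩ : ∃ c : S.X₂ ⟶ S.X₁, c ≫ S.f = 𝟙 _ - a ≫ b :=
    ⟨hS.exact.lift (𝟙 _ - a ≫ b) (by simp [Preadditive.sub_comp, hb, reassoc_of% ha]),
      hS.exact.lift_f _ _⟩
  refine hK.of_retract hE a' b' S.f c ?_
  rw [← cancel_mono S.f]
  simp [Preadditive.add_comp, hb', reassoc_of% ha', hc]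

/-- A Schanuel argument for cokernels: two short exact sequences with the same left end which map
to each other under it. -/
theorem exists_retract_of_shortExact_right
    {S T : ShortComplex (ModuleCat.{u} R)} (hS : S.ShortExact) (hT : T.ShortExact)
    (a : S.X₂ ⟶ T.X₂) (b : T.X₂ ⟶ S.X₂) (e : S.X₁ ≅ T.X₁)
    (ha : S.f ≫ a = e.hom ≫ T.f) (hb : T.f ≫ b = e.inv ≫ S.f) :
    ∃ (a' : S.X₃ ⟶ T.X₃) (b' : T.X₃ ⟶ S.X₃) (c : S.X₃ ⟶ S.X₂),
      T.g ≫ b' = b ≫ S.g ∧ a' ≫ b' + c ≫ S.g = 𝟙 _ := by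
  have := hS.epi_g
  have := hT.epi_g
  obtain ⟨a', ha'⟩ : ∃ a' : S.X₃ ⟶ T.X₃, S.g ≫ a' = a ≫ T.g :=
    ⟨hS.exact.desc (a ≫ T.g) (by simp [reassoc_of% ha]), hS.exact.g_desc _ _⟩
  obtain ⟨b', hb'⟩ : ∃ b' : T.X₃ ⟶ S.X₃, T.g ≫ b' = b ≫ S.g :=
    ⟨hT.exact.desc (b ≫ S.g) (by simp [reassoc_of% hb]), hT.exact.g_desc _ _⟩
  obtain ⟨c, hc⟩ : ∃ c : S.X₃ ⟶ S.X₂, S.g ≫ c = 𝟙 _ - a ≫ b :=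
    ⟨hS.exact.desc (𝟙 _ - a ≫ b) (by simp [Preadditive.comp_sub, hb, reassoc_of% ha]),
      hS.exact.g_desc _ _⟩
  refine ⟨a', b', c, hb', ?_⟩
  rw [← cancel_epi S.g]
  simp [Preadditive.comp_add, hb', reassoc_of% ha', reassoc_of% hc]

section Cycles

variable {C : CochainComplex (ModuleCat.{u} R) ℤ}

/-- The sequence `0 → Zᵃ → Cᵃ → Zᵇ → 0` of cycles of a cochain complex. -/
noncomputable def cyclesShortComplex (C : CochainComplex (ModuleCat.{u} R) ℤ) (a b c : ℤ) :
    ShortComplex (ModuleCat.{u} R) :=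
  ShortComplex.mk (kernel.ι (C.d a b)) (kernel.lift (C.d b c) (C.d a b) (C.d_comp_d a b c))
    (by rw [← cancel_mono (kernel.ι (C.d b c))]; simp)

theorem shortExact_cyclesShortComplex {a b c : ℤ} (hab : a + 1 = b) (hbc : b + 1 = c)
    (hC : C.ExactAt b) : (cyclesShortComplex C a b c).ShortExact where
  mono_f := by dsimp [cyclesShortComplex]; infer_instance
  epi_g := by
    rw [C.exactAt_iff' a b c (by simp; omega) (by simp; omega)] at hC
    exact hC.epi_kernelLift
  exact := by
    let φ : cyclesShortComplex C a b c ⟶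
        ShortComplex.mk (kernel.ι (C.d a b)) (C.d a b) (kernel.condition _) :=
      { τ₁ := 𝟙 _
        τ₂ := 𝟙 _
        τ₃ := kernel.ι (C.d b c)
        comm₁₂ := by simp [cyclesShortComplex]
        comm₂₃ := by simp [cyclesShortComplex] }
    have : Epi φ.τ₁ := inferInstanceAs (Epi (𝟙 _))
    have : IsIso φ.τ₂ := inferInstanceAs (IsIso (𝟙 _))
    have : Mono φ.τ₃ := inferInstanceAs (Mono (kernel.ι _))
    rw [ShortComplex.exact_iff_of_epi_of_isIso_of_mono φ]
    exact ShortComplex.exact_kernel _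

theorem exists_lift_cycles
    (hlift : ∀ I : ModuleCat.{u} R, Injective I →
      ∀ (i : ℤ) (f : I ⟶ C.X i), f ≫ C.d i (i + 1) = 0 →
        ∃ g : I ⟶ C.X (i - 1), f = g ≫ C.d (i - 1) i) {a b c : ℤ} (hab : a + 1 = b)
    (hbc : b + 1 = c) (I : ModuleCat.{u} R) (hI : Injective I) (t : I ⟶ kernel (C.d b c)) :
    ∃ s : I ⟶ C.X a, s ≫ kernel.lift (C.d b c) (C.d a b) (C.d_comp_d a b c) = t := by
  obtain rfl : a = b - 1 := by omega
  subst hbc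
  obtain ⟨g, hg⟩ := hlift I hI b (t ≫ kernel.ι (C.d b (b + 1))) (by simp)
  refine ⟨g, ?_⟩
  rw [← cancel_mono (kernel.ι (C.d b (b + 1))), hg]
  simp

theorem isGorensteinInjective_cycles (hinj : ∀ i, Injective (C.X i)) (hex : ∀ i, C.ExactAt i)
    (hlift : ∀ I : ModuleCat.{u} R, Injective I →
      ∀ (i : ℤ) (f : I ⟶ C.X i), f ≫ C.d i (i + 1) = 0 →
        ∃ g : I ⟶ C.X (i - 1), f = g ≫ C.d (i - 1) i) {a b : ℤ} (hab : a + 1 = b) :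
    IsGorensteinInjective (kernel (C.d a b)) := by
  subst hab
  let D : CochainComplex (ModuleCat.{u} R) ℤ :=
    { X := fun j => C.X (j + a)
      d := fun j k => C.d (j + a) (k + a)
      shape := fun j k hjk => C.shape _ _ (by simp at hjk ⊢; omega)
      d_comp_d' := fun i j k _ _ => C.d_comp_d _ _ _ }
  have hiso : ∀ p q, p = a → q = a + 1 →
      Nonempty (kernel (C.d a (a + 1)) ≅ kernel (C.d p q)) := by
    rintro _ _ rfl rfl
    exact ⟨Iso.refl _⟩
  have hlift' : ∀ I : ModuleCat.{u} R, Injective I → ∀ i j k : ℤ, j = i + 1 → k = j + 1 →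
      ∀ f : I ⟶ C.X j, f ≫ C.d j k = 0 → ∃ g : I ⟶ C.X i, f = g ≫ C.d i j := by
    rintro I hI i j _ hj rfl f hf
    obtain rfl : i = j - 1 := by omega
    exact hlift I hI j f hf
  refine ⟨D, fun i => hinj _, fun i => ?_, hiso (0 + a) (1 + a) (by omega) (by omega),
    fun I hI i f hf => hlift' I hI (i - 1 + a) (i + a) (i + 1 + a) (by omega) (by omega) f hf⟩
  rw [D.exactAt_iff' (i - 1) i (i + 1) (by simp) (by simp)]
  exact (C.exactAt_iff' (i - 1 + a) (i + a) (i + 1 + a) (by simp; omega) (by simp; omega)).1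
    (hex (i + a))

end Cycles

/-- A Gorenstein injective module `N` has an injective precover with Gorenstein injective
kernel. -/
theorem IsGorensteinInjective.exists_precover {N : ModuleCat.{u} R}
    (hN : IsGorensteinInjective N) :
    ∃ S : ShortComplex (ModuleCat.{u} R), S.ShortExact ∧ Nonempty (S.X₃ ≅ N) ∧ Injective S.X₂ ∧
      IsGorensteinInjective S.X₁ ∧
      ∀ I : ModuleCat.{u} R, Injective I → ∀ t : I ⟶ S.X₃, ∃ s : I ⟶ S.X₂, s ≫ S.g = t := by
  obtain ⟨C, hinj, hex, ⟨e⟩, hlift⟩ := hN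
  refine ⟨cyclesShortComplex C (0 - 1) 0 1, shortExact_cyclesShortComplex rfl rfl (hex 0),
    ⟨e.symm⟩, hinj _, isGorensteinInjective_cycles hinj hex hlift rfl,
    exists_lift_cycles hlift rfl rfl⟩

/-- A Gorenstein injective module `N` embeds in an injective module with Gorenstein injective
cokernel, in such a way that maps from injective modules to the cokernel lift. -/
theorem IsGorensteinInjective.exists_embedding {N : ModuleCat.{u} R}
    (hN : IsGorensteinInjective N) :
    ∃ S : ShortComplex (ModuleCat.{u} R), S.ShortExact ∧ Nonempty (S.X₁ ≅ N) ∧ Injective S.X₂ ∧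
      IsGorensteinInjective S.X₃ ∧
      ∀ I : ModuleCat.{u} R, Injective I → ∀ t : I ⟶ S.X₃, ∃ s : I ⟶ S.X₂, s ≫ S.g = t := by
  obtain ⟨C, hinj, hex, ⟨e⟩, hlift⟩ := hN
  refine ⟨cyclesShortComplex C 0 1 2, shortExact_cyclesShortComplex rfl rfl (hex 1),
    ⟨e.symm⟩, hinj _, isGorensteinInjective_cycles hinj hex hlift rfl,
    exists_lift_cycles hlift rfl rfl⟩

theorem tensor_exactAt_iff (C : ChainComplex (ModuleCat.{u} R) ℤ) (I : ModuleCat.{u} R)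
    {i j k : ℤ} (hij : j + 1 = i) (hjk : k + 1 = j) :
    (((tensorLeft I).mapHomologicalComplex (ComplexShape.down ℤ)).obj C).ExactAt j ↔
      Function.Exact ((C.d i j).hom.lTensor I) ((C.d j k).hom.lTensor I) := by
  rw [HomologicalComplex.exactAt_iff' _ i j k (by simp; omega) (by simp; omega),
    ShortComplex.ShortExact.moduleCat_exact_iff_function_exact]
  rfl

/-- Isomorphic modules have isomorphic Pontryagin duals. -/
noncomputable def characterDualIso {M N : ModuleCat.{u} R} (e : M ≅ N) :
    characterDual M ≅ characterDual N where
  hom := characterDualMap e.inv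
  inv := characterDualMap e.hom
  hom_inv_id := by rw [← characterDualMap_comp, e.hom_inv_id]; rfl
  inv_hom_id := by rw [← characterDualMap_comp, e.inv_hom_id]; rfl

theorem injective_characterDual (M : ModuleCat.{u} R) [Module.Flat R M] :
    Injective (characterDual M) :=
  (Module.injective_iff_injective_object R _).1
    (Module.Flat.iff_characterModule_injective.1 inferInstance)

/-- The Pontryagin dual of a Gorenstein flat module is Gorenstein injective. -/
theorem IsGorensteinFlat.isGorensteinInjective_characterDual {M : ModuleCat.{u} R}
    (hM : IsGorensteinFlat M) : IsGorensteinInjective (characterDual M) := by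
  obtain ⟨C, hflat, hex, ⟨e⟩, htens⟩ := hM
  let D : CochainComplex (ModuleCat.{u} R) ℤ :=
    { X := fun i => characterDual (C.X i)
      d := fun i j => characterDualMap (C.d j i)
      shape := fun i j hij => by rw [C.shape _ _ hij, characterDualMap_zero]
      d_comp_d' := fun i j k _ _ => by
        rw [← characterDualMap_comp, C.d_comp_d, characterDualMap_zero] }
  refine ⟨D, fun i => injective_characterDual _, fun i => ?_, ?_, fun I hI i f hf => ?_⟩
  · rw [D.exactAt_iff' (i - 1) i (i + 1) (by simp) (by simp)]
    exact exact_characterDual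
      ((C.exactAt_iff' (i + 1) i (i - 1) (by simp) (by simp)).1 (hex i))
  · have hS : (ShortComplex.mk (C.d 1 0) (cokernel.π (C.d 1 0)) (cokernel.condition _)).Exact :=
      ShortComplex.exact_cokernel _
    have hS' := exact_characterDual hS
    have : Mono (characterDualShortComplex
        (ShortComplex.mk (C.d 1 0) (cokernel.π (C.d 1 0)) (cokernel.condition _))).f :=
      (ModuleCat.mono_iff_injective _).2 (CharacterModule.dual_injective_of_surjective _
        ((ModuleCat.epi_iff_surjective _).1 inferInstance))
    exact ⟨characterDualIso e ≪≫
      IsLimit.conePointUniqueUpToIso hS'.fIsKernel (limit.isLimit _)⟩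
  · have hex' := CharacterModule.dual_exact
      ((tensor_exactAt_iff C I (i := i + 1) (k := i - 1) rfl (by omega)).1 (htens I hI i))
    let f' : I →ₗ[R] CharacterModule (C.X i) := f.hom
    have hf' : CharacterModule.dual (C.d (i + 1) i).hom ∘ₗ f' = 0 :=
      congrArg ModuleCat.Hom.hom hf
    obtain ⟨ψ, hψ⟩ := (hex' (CharacterModule.uncurry f')).1
      (CharacterModule.curry_injective (R := R)
        ((CharacterModule.curry_dual_lTensor _ f').trans (hf'.trans (map_zero _).symm)))
    have hg : CharacterModule.dual (C.d i (i - 1)).hom ∘ₗ CharacterModule.curry ψ = f' := by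
      rw [← CharacterModule.curry_dual_lTensor, CharacterModule.uncurry_curry, hψ,
        CharacterModule.curry_uncurry]
    exact ⟨ModuleCat.ofHom (CharacterModule.curry ψ), ModuleCat.hom_ext hg.symm⟩

/-- There is a short exact sequence `0 → A → F → B → 0` with `F` flat which stays exact after
tensoring with injective modules. -/
def HasFlatExtension (A B : ModuleCat.{u} R) : Prop :=
  ∃ (F : ModuleCat.{u} R) (j : A ⟶ F) (p : F ⟶ B) (w : j ≫ p = 0),
    (ShortComplex.mk j p w).ShortExact ∧ Module.Flat R F ∧
    ∀ I : ModuleCat.{u} R, Injective I → Function.Injective (j.hom.lTensor I)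

theorem isGorensteinFlat_of_hasFlatExtension (Z : ℤ → ModuleCat.{u} R)
    (h : ∀ i, HasFlatExtension (Z (i + 1)) (Z i)) : IsGorensteinFlat (Z 0) := by
  choose F j p w hS hF hI using h
  have hinj : ∀ i, Function.Injective (j i).hom := fun i => (hS i).moduleCat_injective_f
  have hsurj : ∀ i, Function.Surjective (p i).hom := fun i => (hS i).moduleCat_surjective_g
  have hexact : ∀ i, Function.Exact (j i).hom (p i).hom := fun i =>
    (ShortComplex.ShortExact.moduleCat_exact_iff_function_exact _).1 (hS i).exact
  let C : ChainComplex (ModuleCat.{u} R) ℤ := ChainComplex.of F (fun i => p (i + 1) ≫ j i)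
    (fun i => by rw [Category.assoc, reassoc_of% (w (i + 1)), zero_comp, comp_zero])
  have hd : ∀ i, C.d (i + 1) i = p (i + 1) ≫ j i := fun i =>
    ChainComplex.of_d F (fun i => p (i + 1) ≫ j i) i
  refine ⟨C, hF, fun i => ?_, ?_, fun I hI' i => ?_⟩
  · obtain ⟨k, rfl⟩ : ∃ k, i = k + 1 := ⟨i - 1, by omega⟩
    rw [C.exactAt_iff' (k + 1 + 1) (k + 1) k (by simp) (by simp),
      ShortComplex.ShortExact.moduleCat_exact_iff_function_exact]
    change Function.Exact (C.d (k + 1 + 1) (k + 1)).hom (C.d (k + 1) k).hom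
    rw [hd, hd, ModuleCat.hom_comp, ModuleCat.hom_comp, (hsurj _).comp_exact_iff_exact,
      (hinj _).comp_exact_iff_exact]
    exact hexact _
  · have hex : (ShortComplex.mk (C.d 1 0) (p 0) (by
        rw [show C.d 1 0 = _ from hd 0, Category.assoc, w, comp_zero])).Exact := by
      rw [ShortComplex.ShortExact.moduleCat_exact_iff_function_exact]
      change Function.Exact (C.d (0 + 1) 0).hom (p 0).hom
      rw [hd, ModuleCat.hom_comp, (hsurj _).comp_exact_iff_exact]
      exact hexact _
    have : Epi (ShortComplex.mk (C.d 1 0) (p 0) (by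
        rw [show C.d 1 0 = _ from hd 0, Category.assoc, w, comp_zero])).g := (hS 0).epi_g
    exact ⟨IsColimit.coconePointUniqueUpToIso hex.gIsCokernel (colimit.isColimit _)⟩
  · obtain ⟨k, rfl⟩ : ∃ k, i = k + 1 := ⟨i - 1, by omega⟩
    rw [tensor_exactAt_iff C I rfl rfl, hd, hd, ModuleCat.hom_comp, ModuleCat.hom_comp,
      LinearMap.lTensor_comp, LinearMap.lTensor_comp,
      (LinearMap.lTensor_surjective I (hsurj _)).comp_exact_iff_exact,
      (hI _ I hI').comp_exact_iff_exact]
    exact lTensor_exact I (hexact _) (hsurj _)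

/-- A class of modules in which every module is both a left and a right end of a flat extension
within the class consists of Gorenstein flat modules. -/
theorem isGorensteinFlat_of_closed (𝒞 : ModuleCat.{u} R → Prop)
    (hl : ∀ M, 𝒞 M → ∃ N, 𝒞 N ∧ HasFlatExtension N M)
    (hr : ∀ M, 𝒞 M → ∃ N, 𝒞 N ∧ HasFlatExtension M N) (M : ModuleCat.{u} R) (hM : 𝒞 M) :
    IsGorensteinFlat M := by
  choose! l hl𝒞 hl using hl
  choose! r hr𝒞 hr using hr
  have h1 : ∀ n : ℕ, 𝒞 (l^[n] M) := fun n => by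
    induction n with
    | zero => exact hM
    | succ n ih => rw [Function.iterate_succ_apply']; exact hl𝒞 _ ih
  have h2 : ∀ n : ℕ, 𝒞 (r^[n] M) := fun n => by
    induction n with
    | zero => exact hM
    | succ n ih => rw [Function.iterate_succ_apply']; exact hr𝒞 _ ih
  let Z : ℤ → ModuleCat.{u} R := fun i => match i with
    | Int.ofNat n => l^[n] M
    | Int.negSucc n => r^[n + 1] M
  refine isGorensteinFlat_of_hasFlatExtension Z fun i => ?_
  match i with
  | Int.ofNat n =>
    change HasFlatExtension (l^[n + 1] M) (l^[n] M)
    rw [Function.iterate_succ_apply']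
    exact hl _ (h1 n)
  | Int.negSucc 0 => exact hr _ hM
  | Int.negSucc (n + 1) =>
    change HasFlatExtension (r^[n + 1] M) (r^[n + 1 + 1] M)
    rw [Function.iterate_succ_apply' r (n + 1)]
    exact hr _ (h2 (n + 1))

/-- If Gorenstein injectivity is `𝒳`-pure injectivity, then every module with Gorenstein injective
dual is a quotient of a flat module by such a module. -/
theorem exists_hasFlatExtension_left {𝒳 : ModuleCat.{u} R → Prop}
    (h : ∀ M : ModuleCat.{u} R, XPureInjective 𝒳 M ↔ IsGorensteinInjective M)
    (M : ModuleCat.{u} R) (hM : IsGorensteinInjective (characterDual M)) :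
    ∃ N, IsGorensteinInjective (characterDual N) ∧ HasFlatExtension N M := by
  let S : ShortComplex (ModuleCat.{u} R) :=
    ShortComplex.mk (kernel.ι (Projective.π M)) (Projective.π M) (kernel.condition _)
  have hS : S.ShortExact :=
    { exact := ShortComplex.exact_kernel _
      mono_f := inferInstanceAs (Mono (kernel.ι (Projective.π M)))
      epi_g := inferInstanceAs (Epi (Projective.π M)) }
  have hproj : Module.Projective R S.X₂ :=
    (IsProjective.iff_projective _).2 (inferInstanceAs (Projective (Projective.over M)))
  have hinj : Injective (characterDualShortComplex S).X₂ := injective_characterDual S.X₂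
  obtain ⟨T, hT, ⟨e⟩, hTinj, hG, hlift⟩ := hM.exists_embedding
  have hS' := shortExact_characterDual hS
  have := hS'.mono_f
  have := hT.mono_f
  let e' : (characterDualShortComplex S).X₁ ≅ T.X₁ := e.symm
  obtain ⟨a', b', c, hb', hsplit⟩ := exists_retract_of_shortExact_right hS' hT
    (Injective.factorThru (e'.hom ≫ T.f) (characterDualShortComplex S).f)
    (Injective.factorThru (e'.inv ≫ (characterDualShortComplex S).f) T.f) e'
    (Injective.comp_factorThru _ _) (Injective.comp_factorThru _ _)
  refine ⟨S.X₁, (h _).1 (XPureInjective.of_retract ((h _).2 hG)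
    (xPureInjective_of_injective 𝒳 _) a' b' c _ hsplit), S.X₂, S.f, S.g, S.zero, hS,
    inferInstance, fun I hI => CharacterModule.lTensor_injective_of_lifts fun t => ?_⟩
  let t' : I ⟶ (characterDualShortComplex S).X₃ := ModuleCat.ofHom t
  obtain ⟨s, hs⟩ := hlift I hI (t' ≫ a')
  suffices H : ∃ v : I ⟶ (characterDualShortComplex S).X₂,
      v ≫ (characterDualShortComplex S).g = t' by
    obtain ⟨v, hv⟩ := H
    exact ⟨v.hom, congrArg ModuleCat.Hom.hom hv⟩
  refine ⟨s ≫ Injective.factorThru (e'.inv ≫ (characterDualShortComplex S).f) T.f + t' ≫ c, ?_⟩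
  rw [Preadditive.add_comp, Category.assoc, Category.assoc, ← hb', reassoc_of% hs,
    ← Preadditive.comp_add, hsplit, Category.comp_id]

/-- Over a coherent ring, if Gorenstein injectivity is `𝒳`-pure injectivity, then every module
with Gorenstein injective dual embeds in a flat module with such a cokernel. -/
theorem exists_hasFlatExtension_right {𝒳 : ModuleCat.{u} R → Prop} (hcoh : IsCoherentRing R)
    (h : ∀ M : ModuleCat.{u} R, XPureInjective 𝒳 M ↔ IsGorensteinInjective M)
    (M : ModuleCat.{u} R) (hM : IsGorensteinInjective (characterDual M)) :
    ∃ N, IsGorensteinInjective (characterDual N) ∧ HasFlatExtension M N := by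
  obtain ⟨T, hT, ⟨e⟩, hTinj, hK, hlift⟩ := hM.exists_precover
  have : Module.Injective R T.X₂ := (Module.injective_iff_injective_object R _).2 hTinj
  have hflat : Module.Flat R (characterDual T.X₂) := hcoh.flat_characterModule T.X₂
  let q : T.X₂ →ₗ[R] CharacterModule M := (T.g ≫ e.hom).hom
  have hq : Function.Surjective q :=
    e.toLinearEquiv.surjective.comp hT.moduleCat_surjective_g
  let ev (A : ModuleCat.{u} R) : A →ₗ[R] CharacterModule (CharacterModule A) :=
    CharacterModule.curry (CharacterModule.dual
      (TensorProduct.comm R A (CharacterModule A)).toLinearMap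
      (CharacterModule.uncurry LinearMap.id))
  let j : M ⟶ characterDual T.X₂ := ModuleCat.ofHom (CharacterModule.dual q ∘ₗ ev M)
  have hj : ∀ (m : M) (x : T.X₂), (show CharacterModule T.X₂ from j m) x = q x m :=
    fun m x => rfl
  have hjmono : Mono j := by
    rw [ModuleCat.mono_iff_injective, injective_iff_map_eq_zero]
    intro m hm
    refine CharacterModule.eq_zero_of_character_apply fun c => ?_
    obtain ⟨x, rfl⟩ := hq c
    rw [← hj, hm]
    rfl
  let S : ShortComplex (ModuleCat.{u} R) :=
    ShortComplex.mk j (cokernel.π j) (cokernel.condition _)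
  have hS : S.ShortExact :=
    { exact := ShortComplex.exact_cokernel _
      mono_f := hjmono
      epi_g := inferInstanceAs (Epi (cokernel.π j)) }
  have hS' := shortExact_characterDual hS
  have hinj : Injective (characterDualShortComplex S).X₂ :=
    injective_characterDual (characterDual T.X₂)
  let b : T.X₂ ⟶ (characterDualShortComplex S).X₂ := ModuleCat.ofHom (ev T.X₂)
  let e' : (characterDualShortComplex S).X₃ ≅ T.X₃ := e.symm
  have hb : b ≫ (characterDualShortComplex S).g = T.g ≫ e'.inv := rfl
  obtain ⟨a, ha⟩ := hlift _ hinj ((characterDualShortComplex S).g ≫ e'.hom)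
  refine ⟨S.X₃, (h _).1 (XPureInjective.of_shortExact_left hS' hT a b e' ha hb
    (xPureInjective_of_injective 𝒳 _) ((h _).2 hK)), S.X₂, S.f, S.g, S.zero, hS,
    hflat, fun I hI => CharacterModule.lTensor_injective_of_lifts fun t => ?_⟩
  let t' : I ⟶ (characterDualShortComplex S).X₃ := ModuleCat.ofHom t
  obtain ⟨s, hs⟩ := hlift I hI (t' ≫ e'.hom)
  have hv : (s ≫ b) ≫ (characterDualShortComplex S).g = t' := by
    rw [Category.assoc, hb, reassoc_of% hs, e'.hom_inv_id, Category.comp_id]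
  exact ⟨(s ≫ b).hom, congrArg ModuleCat.Hom.hom hv⟩

/-- Over a coherent ring, if the `GP`-pure injective modules are exactly the
Gorenstein injective modules, then the `GP`-pure flat modules are exactly the Gorenstein
flat modules. -/
theorem stmt7 {R : Type u} [CommRing R] (hcoh : IsCoherentRing R)
    (h : ∀ M : ModuleCat.{u} R, GPPureInjective M ↔ IsGorensteinInjective M) :
    ∀ M : ModuleCat.{u} R, GPPureFlat M ↔ IsGorensteinFlat M := by
  intro M
  exact (xPureFlat_iff_xPureInjective_characterDual _ M).trans ((h _).trans
    ⟨isGorensteinFlat_of_closed (fun M => IsGorensteinInjective (characterDual M))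
      (exists_hasFlatExtension_left h) (exists_hasFlatExtension_right hcoh h) M,
      IsGorensteinFlat.isGorensteinInjective_characterDual⟩)
end

section
/- Let R be a commutative ring and M a GP-pure injective R-module of finite Gorenstein injective dimension. Then M is Gorenstein injective. -/
open CategoryTheory Opposite Limits MonoidalCategory

universe u

variable {R : Type u} [CommRing R]

open CategoryTheory.Abelian

section Abelian

variable {C : Type*} [Category* C] [Abelian C]

lemma shortExact_cokernel {X Y : C} (f : X ⟶ Y) [Mono f] :
    (ShortComplex.mk f (cokernel.π f) (cokernel.condition f)).ShortExact where
  exact := ShortComplex.exact_of_g_is_cokernel _ (cokernelIsCokernel f)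

section ShortExact

variable {X Y Z : C} {f : X ⟶ Y} {g : Y ⟶ Z} {w : f ≫ g = 0}

lemma shortExact_pullback_snd (hS : (ShortComplex.mk f g w).ShortExact) {W : C} (h : W ⟶ Z) :
    (ShortComplex.mk (pullback.lift f (0 : X ⟶ W) (by simp [w])) (pullback.snd g h)
      (pullback.lift_snd _ _ _)).ShortExact := by
  have : Mono f := hS.mono_f
  have : Epi g := hS.epi_g
  have : Mono (pullback.lift f (0 : X ⟶ W) (by simp [w]) : X ⟶ pullback g h) :=
    mono_of_mono_fac (pullback.lift_fst _ _ _)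
  refine ⟨ShortComplex.exact_of_f_is_kernel _ (KernelFork.IsLimit.ofι' _ _ fun {A} k hk ↦ ?_)⟩
  refine ⟨hS.exact.lift (k ≫ pullback.fst _ _) ?_, pullback.hom_ext ?_ ?_⟩
  · simpa [pullback.condition] using hk =≫ h
  · simpa only [Category.assoc, pullback.lift_fst] using hS.exact.lift_f _ _
  · simpa [pullback.lift_snd] using hk.symm

lemma shortExact_pullback_fst (hS : (ShortComplex.mk f g w).ShortExact) {W : C} (h : W ⟶ Z) :
    (ShortComplex.mk (pullback.lift (0 : X ⟶ W) f (by simp [w])) (pullback.fst h g)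
      (pullback.lift_fst _ _ _)).ShortExact := by
  refine ShortComplex.shortExact_of_iso ?_ (shortExact_pullback_snd hS h)
  refine ShortComplex.isoMk (Iso.refl _) (pullbackSymmetry _ _) (Iso.refl _) ?_ ?_
  · apply pullback.hom_ext
    · simp [pullback.lift_fst, pullback.lift_snd]
    · simp [pullback.lift_fst, pullback.lift_snd]
  · simp

lemma shortExact_comp (hS : (ShortComplex.mk f g w).ShortExact) {W : C} (p : W ⟶ Y) [Epi p] :
    (ShortComplex.mk (pullback.fst p f) (p ≫ g)
      (by rw [← Category.assoc, pullback.condition, Category.assoc, w, comp_zero])).ShortExact := by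
  have : Mono f := hS.mono_f
  have : Epi g := hS.epi_g
  have : Epi (p ≫ g) := epi_comp p g
  refine ⟨ShortComplex.exact_of_f_is_kernel _ (KernelFork.IsLimit.ofι' _ _ fun {A} k hk ↦ ?_)⟩
  exact ⟨pullback.lift k (hS.exact.lift (k ≫ p) (by simpa using hk))
    (hS.exact.lift_f _ _).symm, pullback.lift_fst _ _ _⟩

lemma exact_of_fac (hS : (ShortComplex.mk f g w).Exact) {X' Z' : C} (p : X' ⟶ X) [Epi p]
    (q : Z ⟶ Z') [Mono q] {d : X' ⟶ Y} {d' : Y ⟶ Z'} (w' : d ≫ d' = 0) (hd : d = p ≫ f)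
    (hd' : d' = g ≫ q) : (ShortComplex.mk d d' w').Exact := by
  subst hd hd'
  have h : (ShortComplex.mk (p ≫ f) g (by simp [w])).Exact :=
    (ShortComplex.exact_iff_of_epi_of_isIso_of_mono (S₂ := ShortComplex.mk f g w)
      { τ₁ := p, τ₂ := 𝟙 Y, τ₃ := 𝟙 Z }).2 hS
  exact (ShortComplex.exact_iff_of_epi_of_isIso_of_mono (S₁ := ShortComplex.mk (p ≫ f) g _)
    (S₂ := ShortComplex.mk (p ≫ f) (g ≫ q) _) { τ₁ := 𝟙 X', τ₂ := 𝟙 Y, τ₃ := q }).1 h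

lemma shortExact_kernel_lift (h : (ShortComplex.mk f g w).Exact) :
    (ShortComplex.mk (kernel.ι f) (kernel.lift g f w)
      (by rw [← cancel_mono (kernel.ι g)]; simp)).ShortExact := by
  have : Epi (kernel.lift g f w) := h.epi_kernelLift
  refine ⟨ShortComplex.exact_of_f_is_kernel _ (KernelFork.IsLimit.ofι' _ _ fun {A} k hk ↦ ?_)⟩
  exact ⟨kernel.lift f k (by simpa using hk =≫ kernel.ι g), kernel.lift_ι _ _ _⟩

lemma shortExact_cokernel_desc (h : (ShortComplex.mk f g w).Exact) :
    (ShortComplex.mk (cokernel.desc f g w) (cokernel.π g)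
      (by rw [← cancel_epi (cokernel.π f)]; simp)).ShortExact := by
  have : Mono (cokernel.desc f g w) := h.mono_cokernelDesc
  refine ⟨ShortComplex.exact_of_g_is_cokernel _
    (CokernelCofork.IsColimit.ofπ' _ _ fun {A} k hk ↦ ?_)⟩
  exact ⟨cokernel.desc g k (by simpa using cokernel.π f ≫= hk), cokernel.π_desc _ _ _⟩

end ShortExact

section Ext

variable [HasExt.{w} C]

lemma CategoryTheory.ShortComplex.ShortExact.exists_lift_of_ext {S : ShortComplex C}
    (hS : S.ShortExact) {Q : C} (h : ∀ e : Ext Q S.X₁ 1, e = 0) (φ : Q ⟶ S.X₃) :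
    ∃ ψ : Q ⟶ S.X₂, ψ ≫ S.g = φ := by
  obtain ⟨x, hx⟩ := Ext.covariant_sequence_exact₃ Q hS (Ext.mk₀ φ) (zero_add 1) (h _)
  obtain ⟨ψ, rfl⟩ := Ext.addEquiv₀.symm.surjective x
  refine ⟨ψ, Ext.addEquiv₀.symm.injective ?_⟩
  simpa using hx

lemma CategoryTheory.ShortComplex.ShortExact.exists_desc_of_ext {S : ShortComplex C}
    (hS : S.ShortExact) {Y : C} (h : ∀ e : Ext S.X₃ Y 1, e = 0) (φ : S.X₁ ⟶ Y) :
    ∃ ψ : S.X₂ ⟶ Y, S.f ≫ ψ = φ := by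
  obtain ⟨x, hx⟩ := Ext.contravariant_sequence_exact₁ hS Y (Ext.mk₀ φ) (add_zero 1) (h _)
  obtain ⟨ψ, rfl⟩ := Ext.addEquiv₀.symm.surjective x
  refine ⟨ψ, Ext.addEquiv₀.symm.injective ?_⟩
  simpa using hx

/-- The groups `Ext^n(J, X)` vanish for all injective objects `J` and all `n ≥ 1`. -/
def InjPerp (X : C) : Prop :=
  ∀ J : C, Injective J → ∀ (n : ℕ) (e : Ext J X (n + 1)), e = 0

lemma InjPerp.of_injective {X : C} [Injective X] : InjPerp X :=
  fun _ _ _ e ↦ e.eq_zero_of_injective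

lemma InjPerp.of_retract {X Y : C} (hY : InjPerp Y) (r : Retract X Y) : InjPerp X := by
  intro J hJ n e
  have h := hY J hJ n (e.comp (Ext.mk₀ r.i) (add_zero _))
  rw [← e.comp_mk₀_id, ← r.retract, ← Ext.mk₀_comp_mk₀, ← Ext.comp_assoc_of_third_deg_zero, h,
    Ext.zero_comp]

lemma InjPerp.X₂ {S : ShortComplex C} (hS : S.ShortExact) (h₁ : InjPerp S.X₁)
    (h₃ : InjPerp S.X₃) : InjPerp S.X₂ := by
  intro J hJ n e
  obtain ⟨x, rfl⟩ := Ext.covariant_sequence_exact₂ J hS e (h₃ J hJ n _)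
  rw [h₁ J hJ n x, Ext.zero_comp]

lemma InjPerp.X₃ {S : ShortComplex C} (hS : S.ShortExact) (h₁ : InjPerp S.X₁)
    (h₂ : InjPerp S.X₂) : InjPerp S.X₃ := by
  intro J hJ n e
  obtain ⟨x, rfl⟩ := Ext.covariant_sequence_exact₃ J hS e rfl (h₁ J hJ (n + 1) _)
  rw [h₂ J hJ n x, Ext.zero_comp]

/-- An object in `InjPerp` of finite injective dimension is injective. -/
lemma InjPerp.injective [EnoughInjectives C] (n : ℕ) {X : C} (hX : InjPerp X)
    [HasInjectiveDimensionLE X n] : Injective X := by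
  induction n generalizing X with
  | zero => exact injective_iff_hasInjectiveDimensionLT_one.2 ‹_›
  | succ n ih =>
    have hS := shortExact_cokernel (Injective.ι X)
    have : HasInjectiveDimensionLE (cokernel (Injective.ι X)) n :=
      (hS.hasInjectiveDimensionLT_X₃_iff n (inferInstanceAs (Injective (Injective.under X)))).2 ‹_›
    have hJ : Injective (cokernel (Injective.ι X)) := ih (InjPerp.X₃ hS hX .of_injective)
    obtain ⟨r, hr⟩ := hS.exists_desc_of_ext (Y := X) (hX _ hJ 0) (𝟙 _)
    exact Retract.injective (Y := Injective.under X) ⟨_, r, hr⟩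

end Ext

end Abelian

lemma exists_nat_seq {α : Type*} {p : α → Prop} {r : α → α → Prop}
    (h : ∀ x, p x → ∃ y, p y ∧ r x y) {x : α} (hx : p x) :
    ∃ a : ℕ → α, a 0 = x ∧ (∀ n, p (a n)) ∧ ∀ n, r (a n) (a (n + 1)) := by
  have : Nonempty α := ⟨x⟩
  choose! F hF using h
  have hp (n : ℕ) : p (F^[n] x) := by
    induction n with
    | zero => exact hx
    | succ n ih => exact Function.iterate_succ_apply' F n x ▸ (hF _ ih).1
  refine ⟨fun n ↦ F^[n] x, rfl, hp, fun n ↦ ?_⟩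
  simpa only [Function.iterate_succ_apply'] using (hF _ (hp n)).2

lemma exists_int_seq {α : Type*} {p : α → Prop} {r : α → α → Prop} {a b : ℕ → α} (hab : a 0 = b 0)
    (hpa : ∀ n, p (a n)) (hpb : ∀ n, p (b n)) (ha : ∀ n, r (a n) (a (n + 1)))
    (hb : ∀ n, r (b (n + 1)) (b n)) :
    ∃ z : ℤ → α, z 0 = a 0 ∧ (∀ i, p (z i)) ∧ ∀ i, r (z i) (z (i + 1)) := by
  refine ⟨fun i ↦ Int.casesOn i a fun n ↦ b (n + 1), rfl, ?_, ?_⟩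
  · rintro (n | n)
    · exact hpa n
    · exact hpb (n + 1)
  · rintro (n | _ | n)
    · exact ha n
    · change r (b 1) (a 0)
      exact hab ▸ hb 0
    · exact hb (n + 1)

section Gorenstein

variable {R : Type u} [CommRing R]

/-- `Y` is the kernel of an epimorphism from an injective module to `X`. -/
def IsInjSyzygy (Y X : ModuleCat.{u} R) : Prop :=
  ∃ (I : ModuleCat.{u} R) (f : Y ⟶ I) (g : I ⟶ X) (w : f ≫ g = 0),
    Injective I ∧ (ShortComplex.mk f g w).ShortExact

lemma exists_isInjSyzygy {X : ModuleCat.{u} R} (hX : InjPerp X) :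
    ∃ Y : ModuleCat.{u} R, InjPerp Y ∧ IsInjSyzygy X Y := by
  have hS := shortExact_cokernel (Injective.ι X)
  exact ⟨_, InjPerp.X₃ hS hX .of_injective, _, _, _, _,
    inferInstanceAs (Injective (Injective.under X)), hS⟩

lemma isGorensteinInjective_of_int_seq {Z : ℤ → ModuleCat.{u} R} (hZ : ∀ i, InjPerp (Z i))
    (hs : ∀ i, IsInjSyzygy (Z i) (Z (i + 1))) : IsGorensteinInjective (Z 0) := by
  choose I f g w hI hS using hs
  have hmono (i : ℤ) : Mono (f i) := (hS i).mono_f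
  have hepi (i : ℤ) : Epi (g i) := (hS i).epi_g
  let C : CochainComplex (ModuleCat.{u} R) ℤ := CochainComplex.of I (fun i ↦ g i ≫ f (i + 1))
    fun i ↦ by rw [Category.assoc, reassoc_of% w (i + 1), zero_comp, comp_zero]
  have hd (i : ℤ) : C.d i (i + 1) = g i ≫ f (i + 1) :=
    CochainComplex.of_d I (fun i ↦ g i ≫ f (i + 1)) i
  have hker (i : ℤ) {J : ModuleCat.{u} R} (φ : J ⟶ I i) (hφ : φ ≫ C.d i (i + 1) = 0) :
      φ ≫ g i = 0 := by
    rw [← cancel_mono (f (i + 1)), zero_comp, Category.assoc]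
    exact hd i ▸ hφ
  refine ⟨C, hI, fun j ↦ ?_, ⟨?_⟩, fun J hJ i φ hφ ↦ ?_⟩
  · obtain ⟨i, rfl⟩ : ∃ i, j = i + 1 := ⟨j - 1, by simp⟩
    rw [C.exactAt_iff' i (i + 1) (i + 1 + 1) (by simp) (by simp)]
    exact exact_of_fac (hS (i + 1)).exact (g i) (f (i + 1 + 1)) _ (hd i) (hd (i + 1))
  · exact (isKernelCompMono (hS 0).fIsKernel (f (0 + 1)) (hd 0)).conePointUniqueUpToIso
      (limit.isLimit _)
  · obtain ⟨j, rfl⟩ : ∃ j, i = j + 1 := ⟨i - 1, by simp⟩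
    obtain ⟨ψ, hψ⟩ := (hS j).exists_lift_of_ext (hZ j J hJ 0)
      ((hS (j + 1)).exact.lift φ (hker _ φ hφ))
    have : ∀ k, k = j → ∃ χ : J ⟶ C.X k, φ = χ ≫ C.d k (j + 1) := by
      rintro k rfl
      refine ⟨ψ, ?_⟩
      rw [hd, reassoc_of% hψ]
      exact ((hS (k + 1)).exact.lift_f _ _).symm
    exact this _ (by simp)

lemma isGorensteinInjective_of_class {𝒲 : ModuleCat.{u} R → Prop}
    (h : ∀ X, 𝒲 X → InjPerp X ∧ ∃ Y, 𝒲 Y ∧ IsInjSyzygy Y X) {X : ModuleCat.{u} R} (hX : 𝒲 X) :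
    IsGorensteinInjective X := by
  obtain ⟨a, ha₀, hpa, ha⟩ := exists_nat_seq (fun Y hY ↦ exists_isInjSyzygy hY) (h X hX).1
  obtain ⟨b, rfl, hpb, hb⟩ := exists_nat_seq (r := fun Y Z ↦ IsInjSyzygy Z Y)
    (fun Y hY ↦ (h Y hY).2) hX
  obtain ⟨z, hz₀, hpz, hz⟩ := exists_int_seq ha₀ hpa (fun n ↦ (h _ (hpb n)).1) ha hb
  rw [← ha₀, ← hz₀]
  exact isGorensteinInjective_of_int_seq hpz hz

lemma IsGorensteinInjective.injPerp_and_exists {X : ModuleCat.{u} R}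
    (hX : IsGorensteinInjective X) :
    InjPerp X ∧ ∃ Y, IsGorensteinInjective Y ∧ IsInjSyzygy Y X := by
  obtain ⟨C, hC, hex, ⟨e⟩, hlift⟩ := hX
  have hS (i j k : ℤ) (hij : i + 1 = j) (hjk : j + 1 = k) :=
    shortExact_kernel_lift ((C.exactAt_iff' i j k (by simp [← hij]) (by simp [hjk])).1 (hex j))
  have hlift' (i j k : ℤ) (hij : i + 1 = j) (hjk : j + 1 = k) {J : ModuleCat.{u} R}
      (hJ : Injective J) (φ : J ⟶ C.X j) (hφ : φ ≫ C.d j k = 0) :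
      ∃ ψ : J ⟶ C.X i, φ = ψ ≫ C.d i j := by
    obtain rfl : i = j - 1 := by lia
    subst hjk
    exact hlift J hJ j φ hφ
  have hext {J : ModuleCat.{u} R} (hJ : Injective J) (n : ℕ) : ∀ (i j : ℤ), i + 1 = j →
      ∀ x : Ext J (kernel (C.d i j)) (n + 1), x = 0 := by
    induction n with
    | zero =>
      intro i j hij x
      obtain ⟨y, rfl⟩ := Ext.covariant_sequence_exact₁ J (hS i j (j + 1) hij rfl) x
        (@Ext.eq_zero_of_injective _ _ _ _ _ _ _ (hC i) _) (zero_add 1)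
      obtain ⟨φ, rfl⟩ := Ext.addEquiv₀.symm.surjective y
      obtain ⟨ψ, hψ⟩ := hlift' i j (j + 1) hij rfl hJ (φ ≫ kernel.ι _) (by simp)
      obtain rfl : φ = ψ ≫ kernel.lift _ (C.d i j) (C.d_comp_d i j (j + 1)) := by
        rw [← cancel_mono (kernel.ι _), hψ, Category.assoc, kernel.lift_ι]
      have h := (hS i j (j + 1) hij rfl).comp_extClass
      dsimp at h
      simp [← Ext.mk₀_comp_mk₀, h]
    | succ n ih =>
      intro i j hij x
      obtain ⟨y, rfl⟩ := Ext.covariant_sequence_exact₁ J (hS i j (j + 1) hij rfl) x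
        (@Ext.eq_zero_of_injective _ _ _ _ _ _ _ (hC i) _) rfl
      rw [ih j (j + 1) rfl y, Ext.zero_comp]
  have hperp (i j : ℤ) (hij : i + 1 = j) : InjPerp (kernel (C.d i j)) :=
    fun J hJ n x ↦ hext hJ n i j hij x
  have hsyz (i j j' k : ℤ) (hij : i + 1 = j) (hj : j = j') (hjk : j' + 1 = k) :
      IsInjSyzygy (kernel (C.d i j)) (kernel (C.d j' k)) := by
    subst hj
    exact ⟨_, _, _, _, hC i, hS i j k hij hjk⟩
  refine ⟨(hperp 0 1 rfl).of_retract (.ofIso e), kernel (C.d (0 + -1) 0), ?_, ?_⟩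
  · exact isGorensteinInjective_of_int_seq (Z := fun i ↦ kernel (C.d (i + -1) i))
      (fun i ↦ hperp _ _ (by simp)) fun i ↦ hsyz _ _ _ _ (by simp) (by simp) (by simp)
  · obtain ⟨I, f, g, w, hI, h⟩ := hsyz (0 + -1) 0 0 1 rfl rfl rfl
    exact ⟨I, f, g ≫ e.inv, by simp [reassoc_of% w], hI,
      ShortComplex.shortExact_of_iso (S₁ := ShortComplex.mk f g w)
        (ShortComplex.isoMk (Iso.refl _) (Iso.refl _) e.symm (by simp) (by simp)) h⟩

lemma IsGorensteinInjective.X₂ {A X B : ModuleCat.{u} R} {f : A ⟶ X} {g : X ⟶ B} {w : f ≫ g = 0}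
    (hS : (ShortComplex.mk f g w).ShortExact) (hA : IsGorensteinInjective A)
    (hB : IsGorensteinInjective B) : IsGorensteinInjective X := by
  refine isGorensteinInjective_of_class (𝒲 := fun X ↦ ∃ (A B : ModuleCat.{u} R) (f : A ⟶ X)
    (g : X ⟶ B) (w : f ≫ g = 0), IsGorensteinInjective A ∧ IsGorensteinInjective B ∧
      (ShortComplex.mk f g w).ShortExact) ?_ ⟨A, B, f, g, w, hA, hB, hS⟩
  clear! A X B
  rintro X ⟨A, B, f, g, w, hA, hB, hS⟩
  obtain ⟨hA, A', hA', I, i, p, _, hI, hIA⟩ := hA.injPerp_and_exists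
  obtain ⟨hB, B', hB', J, j, q, _, hJ, hJB⟩ := hB.injPerp_and_exists
  refine ⟨InjPerp.X₂ hS hA hB, ?_⟩
  have hW := shortExact_pullback_snd hS q
  obtain ⟨r, hr⟩ := hW.exists_desc_of_ext (hA J hJ 0) (𝟙 A)
  have : Epi (pullback.snd g q) := hW.epi_g
  let s := ShortComplex.Splitting.ofExactOfRetraction _ hW.exact r hr hW.epi_g
  have hr' : (ShortComplex.mk s.s r s.s_r).ShortExact :=
    ShortComplex.Splitting.shortExact
      { r := pullback.snd g q, s := pullback.lift f 0 (by simp [w]), f_r := s.s_g, s_g := hr,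
        id := by rw [add_comm]; exact s.id }
  have hT := shortExact_pullback_fst hIA r
  have : Epi (pullback.fst r p) := hT.epi_g
  have hTinj : HasInjectiveDimensionLT (pullback r p) 1 :=
    (shortExact_pullback_snd hr' p).hasInjectiveDimensionLT_X₂ 1
      (inferInstanceAs (HasInjectiveDimensionLT J 1))
      (inferInstanceAs (HasInjectiveDimensionLT I 1))
  have hWX := shortExact_pullback_fst hJB g
  exact ⟨_, ⟨A', B', _, _, _, hA', hB', shortExact_pullback_snd hT _⟩, _, _, _, _,
    injective_iff_hasInjectiveDimensionLT_one.2 hTinj, shortExact_comp hWX _⟩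

lemma InjPerp.isGorensteinInjective {M E L : ModuleCat.{u} R} {f : M ⟶ E} {g : E ⟶ L}
    {w : f ≫ g = 0} (hM : InjPerp M) (hS : (ShortComplex.mk f g w).ShortExact)
    (hE : IsGorensteinInjective E) (n : ℕ) [hL : HasInjectiveDimensionLE L n] :
    IsGorensteinInjective M := by
  obtain ⟨-, E', hE', I, i, p, _, hI, hIE⟩ := hE.injPerp_and_exists
  have : Epi p := hIE.epi_g
  have hT := shortExact_pullback_snd hIE f
  have hdim : HasInjectiveDimensionLE (pullback p f) (n + 1) :=
    (shortExact_comp hS p).hasInjectiveDimensionLT_X₁ (n + 1) hL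
      (hasInjectiveDimensionLT_of_ge I 1 _ (by lia))
  have hTinj : Injective (pullback p f) :=
    (InjPerp.X₂ hT hE'.injPerp_and_exists.1 hM).injective (n + 1)
  refine isGorensteinInjective_of_class (𝒲 := fun Y ↦ Y = M ∨ IsGorensteinInjective Y) ?_ (.inl rfl)
  rintro Y (rfl | hY)
  · exact ⟨hM, E', .inr hE', _, _, _, _, hTinj, hT⟩
  · obtain ⟨h, Y', hY', hs⟩ := hY.injPerp_and_exists
    exact ⟨h, Y', .inr hY', hs⟩

lemma GidLE.exists_shortExact {n : ℕ} {M : ModuleCat.{u} R} (hM : GidLE n M) :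
    ∃ (E L : ModuleCat.{u} R) (f : M ⟶ E) (g : E ⟶ L) (w : f ≫ g = 0),
      (ShortComplex.mk f g w).ShortExact ∧ IsGorensteinInjective E ∧
        ∃ m, HasInjectiveDimensionLE L m := by
  induction n generalizing M with
  | zero =>
    have hL : HasInjectiveDimensionLT (cokernel (𝟙 M)) 0 :=
      (isZero_cokernel_of_epi (𝟙 M)).hasInjectiveDimensionLT_zero
    exact ⟨M, _, 𝟙 M, _, _, shortExact_cokernel _, hM, 0,
      hasInjectiveDimensionLT_of_ge _ 0 _ (by lia)⟩
  | succ n ih =>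
    obtain ⟨S, hS, ⟨e⟩, hE, hN⟩ := hM
    obtain ⟨E', L, f, g, w, hN', hE', m, hL⟩ := ih hN
    obtain ⟨-, G, hG, I, i, p, _, hI, hIE⟩ := hE'.injPerp_and_exists
    have : Epi p := hIE.epi_g
    have hP := shortExact_pullback_snd hIE f
    have hdim : HasInjectiveDimensionLE (pullback p f) (m + 1) :=
      (shortExact_comp hN' p).hasInjectiveDimensionLT_X₁ (m + 1) hL
        (hasInjectiveDimensionLT_of_ge I 1 _ (by lia))
    have hW := shortExact_pullback_snd hS (pullback.snd p f)
    refine ⟨_, _, e.inv ≫ pullback.lift S.f 0 (by simp), pullback.snd _ _, ?_,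
      ShortComplex.shortExact_of_iso ?_ hW,
      (shortExact_pullback_fst hP S.g |> IsGorensteinInjective.X₂) hG hE, m + 1, hdim⟩
    · rw [Category.assoc, pullback.lift_snd, comp_zero]
    · exact ShortComplex.isoMk e (Iso.refl _) (Iso.refl _) (by simp) (by simp)

lemma IsGorensteinProjective.exists_lift {Q L : ModuleCat.{u} R} (hQ : IsGorensteinProjective Q)
    (n : ℕ) [hL : HasInjectiveDimensionLE L n] {X Y : ModuleCat.{u} R} {f : X ⟶ Y} {g : Y ⟶ L}
    {w : f ≫ g = 0} (hS : (ShortComplex.mk f g w).ShortExact) (φ : Q ⟶ L) :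
    ∃ ψ : Q ⟶ Y, ψ ≫ g = φ := by
  obtain ⟨C, hC, hex, ⟨e⟩, -⟩ := hQ
  have hT (i j k : ℤ) (hij : j + 1 = i) (hjk : k + 1 = j) :=
    shortExact_cokernel_desc ((C.exactAt_iff' i j k (by simp [hij]) (by simp [← hjk])).1 (hex j))
  have hext (m : ℕ) : ∀ k : ℕ, HasInjectiveDimensionLT L (k + 1 + m) → ∀ (i j : ℤ), j + 1 = i →
      ∀ x : Ext (cokernel (C.d i j)) L (k + 1), x = 0 := by
    induction m with
    | zero => exact fun k h i j hij x ↦ x.eq_zero_of_hasInjectiveDimensionLT _ le_rfl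
    | succ m ih =>
      intro k h i j hij x
      obtain ⟨y, rfl⟩ := Ext.contravariant_sequence_exact₁ (hT i j (j - 1) hij (by simp)) L x
        (add_comm 1 _) (ih (k + 1) (by convert h using 1; lia) _ _ (by simp) _)
      rw [@Ext.eq_zero_of_projective _ _ _ _ _ _ _ (hC _) y, Ext.comp_zero]
  have : Projective (C.X (-1)) := hC (-1)
  have : Epi g := hS.epi_g
  obtain ⟨χ, hχ⟩ := (hT 1 0 (-1) rfl rfl).exists_desc_of_ext
    (hext n 0 (by convert hL using 1; lia) 0 (-1) rfl) (e.inv ≫ φ)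
  dsimp at χ hχ
  refine ⟨e.hom ≫ cokernel.desc _ _ (C.d_comp_d 1 0 (-1)) ≫ Projective.factorThru χ g, ?_⟩
  simpa using e.hom ≫= hχ

end Gorenstein


/-- A `GP`-pure injective module of finite Gorenstein injective dimension is
Gorenstein injective. -/
theorem stmt8 {R : Type u} [CommRing R] (M : ModuleCat.{u} R)
    (hM : GPPureInjective M) (hfin : ∃ n : ℕ, GidLE n M) :
    IsGorensteinInjective M := by
  obtain ⟨n, hn⟩ := hfin
  obtain ⟨E, L, f, g, w, hS, hE, m, hL⟩ := GidLE.exists_shortExact hn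
  obtain ⟨r, hr⟩ := hM _ hS (fun Q hQ φ ↦ IsGorensteinProjective.exists_lift hQ m hS φ) (𝟙 M)
  have hM' := (IsGorensteinInjective.injPerp_and_exists hE).1.of_retract ⟨f, r, hr⟩
  exact hM'.isGorensteinInjective hS hE m
end
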